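/- arXiv:1311.1498 — 3 statements merged into one kernel-verified Lean document; each statement's English description precedes it below -/
import Mathlib

section
/- Let f : ℝⁿ → ℝ be a convex C² function satisfying Σ_{i=1}^n a_i(x) · S_i(Hess f(x)) = 0 for all x ∈ ℝⁿ, where the coefficients a_1, …, a_n satisfy condition (Q) and a_1 is not identically zero. If lim sup_{‖x‖→∞} |f(x)|/‖x‖² = 0, then f is affine, i.e. there exist a ∈ ℝ and b ∈ ℝⁿ such that f(x) = a + ⟨b, x⟩ for all x ∈ ℝⁿ. -/
open scoped RealInnerProductSpace

/-- `S_k(A)`: the `k`-th elementary symmetric function of the eigenvalues of the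
`n × n` real matrix `A`, defined by `det (A + t•I) = ∑_{k=0}^n S_k(A) * t^(n-k)`,
i.e. `S_k(A)` is the coefficient of `t^(n-k)` in the polynomial `det (A + t•I)`. -/
noncomputable def elemSym (n k : ℕ) (A : Matrix (Fin n) (Fin n) ℝ) : ℝ :=
  ((A.map Polynomial.C +
      (Polynomial.X : Polynomial ℝ) • (1 : Matrix (Fin n) (Fin n) (Polynomial ℝ))).det).coeff
    (n - k)

/-- The Hessian matrix `(∂²f/∂x_i∂x_j (x))_{1 ≤ i,j ≤ n}` of `f` at `x`. -/
noncomputable def hessian (n : ℕ) (f : EuclideanSpace ℝ (Fin n) → ℝ)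
    (x : EuclideanSpace ℝ (Fin n)) : Matrix (Fin n) (Fin n) ℝ :=
  Matrix.of fun i j =>
    iteratedFDeriv ℝ 2 f x ![EuclideanSpace.single i 1, EuclideanSpace.single j 1]

/-- Condition (Q): for each `k` with `1 ≤ k ≤ n`, either `a_k ≡ 0` on `ℝⁿ`, or there
are positive constants `μ₁ ≤ μ₂` with `μ₁ ≤ |a_k x| ≤ μ₂` for all `x`. -/
def CondQ {E : Type*} (n : ℕ) (a : ℕ → E → ℝ) : Prop :=
  ∀ k ∈ Finset.Icc 1 n,
    (∀ x, a k x = 0) ∨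
      ∃ μ₁ μ₂ : ℝ, 0 < μ₁ ∧ μ₁ ≤ μ₂ ∧ ∀ x, μ₁ ≤ |a k x| ∧ |a k x| ≤ μ₂

/-- `lim sup_{‖x‖ → ∞} |f x| / ‖x‖² = 0`: since the quantity `|f x| / ‖x‖²` is
nonnegative, this is equivalent to `|f x| / ‖x‖² → 0` as `‖x‖ → ∞`. -/
def QuadDecay (n : ℕ) (f : EuclideanSpace ℝ (Fin n) → ℝ) : Prop :=
  Filter.Tendsto (fun x => |f x| / ‖x‖ ^ 2) (Filter.comap norm Filter.atTop) (nhds 0)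

open Filter Topology

/-- `S_k(A)` is a coefficient of the characteristic polynomial of `-A`. -/
lemma elemSym_eq_charpoly_coeff (n k : ℕ) (A : Matrix (Fin n) (Fin n) ℝ) :
    elemSym n k A = (-A).charpoly.coeff (n - k) := by
  unfold elemSym Matrix.charpoly Matrix.charmatrix
  congr 2
  ext1 i j
  simp [Matrix.smul_apply, Matrix.one_apply, Matrix.diagonal_apply, add_comm]

lemma elemSym_one {n : ℕ} (hn : 0 < n) (A : Matrix (Fin n) (Fin n) ℝ) :
    elemSym n 1 A = A.trace := by
  have : Nonempty (Fin n) := ⟨⟨0, hn⟩⟩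
  have h := Matrix.trace_eq_neg_charpoly_coeff (-A)
  rw [Matrix.trace_neg, Fintype.card_fin] at h
  rw [elemSym_eq_charpoly_coeff]
  linarith

/-- For a positive semidefinite matrix, `|S_k(A)| ≤ C(n,k) (tr A)^k`. -/
lemma abs_elemSym_le {n k : ℕ} (hk : k ≤ n) {A : Matrix (Fin n) (Fin n) ℝ} (hA : A.PosSemidef) :
    |elemSym n k A| ≤ A.trace ^ k * n.choose k := by
  have hB : (-A).IsHermitian := hA.isHermitian.neg
  have hle : ∀ i, hB.eigenvalues i ≤ 0 := by
    intro i
    rw [hB.eigenvalues_eq]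
    have := hA.dotProduct_mulVec_nonneg (⇑(hB.eigenvectorBasis i))
    simpa [Matrix.neg_mulVec] using this
  have hsum : A.trace = ∑ i, -hB.eigenvalues i := by
    have := hB.trace_eq_sum_eigenvalues
    rw [Matrix.trace_neg] at this
    simp only [RCLike.ofReal_real_eq_id, id] at this
    rw [Finset.sum_neg_distrib]
    linarith
  have h := Polynomial.coeff_le_of_roots_le (p := (-A).charpoly) (f := RingHom.id ℝ)
    (B := A.trace) (n - k) (-A).charpoly_monic
    (by simpa using hB.splits_charpoly) (by
      intro z hz
      rw [Polynomial.map_id, hB.roots_charpoly_eq_eigenvalues] at hz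
      obtain ⟨i, -, rfl⟩ := Multiset.mem_map.1 hz
      simp only [Function.comp, RCLike.ofReal_real_eq_id, id, Real.norm_eq_abs]
      rw [abs_of_nonpos (hle i), hsum]
      exact Finset.single_le_sum (f := fun i => -hB.eigenvalues i)
        (fun j _ => neg_nonneg.2 (hle j)) (Finset.mem_univ i))
  rw [Polynomial.map_id, Matrix.charpoly_natDegree_eq_dim, Fintype.card_fin, Nat.sub_sub_self hk,
    Nat.choose_symm hk] at h
  rwa [elemSym_eq_charpoly_coeff]

section SecondDerivative

variable {E : Type*} [NormedAddCommGroup E] [NormedSpace ℝ E] {f : E → ℝ}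

lemma hasDerivAt_comp_line (hf : ContDiff ℝ 2 f) (x v : E) (t : ℝ) :
    HasDerivAt (fun t : ℝ => f (x + t • v)) (fderiv ℝ f (x + t • v) v) t := by
  have hl : HasDerivAt (fun t : ℝ => x + t • v) v t := by
    simpa using ((hasDerivAt_id t).smul_const v).const_add x
  exact ((hf.differentiable (by norm_num)) _).hasFDerivAt.comp_hasDerivAt t hl

lemma hasDerivAt_fderiv_comp_line (hf : ContDiff ℝ 2 f) (x v : E) (t : ℝ) :
    HasDerivAt (fun t : ℝ => fderiv ℝ f (x + t • v) v)
      (fderiv ℝ (fderiv ℝ f) (x + t • v) v v) t := by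
  have hl : HasDerivAt (fun t : ℝ => x + t • v) v t := by
    simpa using ((hasDerivAt_id t).smul_const v).const_add x
  have hd : Differentiable ℝ (fderiv ℝ f) :=
    (hf.fderiv_right (m := 1) (by norm_num)).differentiable (by norm_num)
  have h := (hd (x + t • v)).hasFDerivAt.comp_hasDerivAt t hl
  simpa using h.clm_apply (hasDerivAt_const t v)

lemma ConvexOn.fderiv_fderiv_nonneg (hf : ContDiff ℝ 2 f) (hconv : ConvexOn ℝ Set.univ f)
    (x v : E) : 0 ≤ fderiv ℝ (fderiv ℝ f) x v v := by
  have hc : ConvexOn ℝ Set.univ (fun t : ℝ => f (x + t • v)) := by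
    refine ⟨convex_univ, fun s _ t _ a b ha hb hab => ?_⟩
    have h := hconv.2 (Set.mem_univ (x + s • v)) (Set.mem_univ (x + t • v)) ha hb hab
    convert h using 2
    rw [smul_add, smul_add, add_add_add_comm, ← add_smul, hab, one_smul, add_smul, smul_smul,
      smul_smul, smul_eq_mul, smul_eq_mul]
  have hm := hc.monotoneOn_deriv fun t _ => (hasDerivAt_comp_line hf x v t).differentiableAt
  rw [funext fun t => (hasDerivAt_comp_line hf x v t).deriv, monotoneOn_univ] at hm
  have h := hm.deriv_nonneg (x := 0)
  rw [(hasDerivAt_fderiv_comp_line hf x v 0).deriv] at h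
  simpa using h

end SecondDerivative

/-- The second derivative is nonpositive at a local maximum. -/
lemma IsLocalMax.deriv_deriv_nonpos {φ : ℝ → ℝ} {t : ℝ} (h : IsLocalMax φ t)
    (hc : ContinuousAt φ t) : deriv (deriv φ) t ≤ 0 := by
  by_contra! hpos
  have hmin := isLocalMin_of_deriv_deriv_pos hpos h.deriv_eq_zero hc
  have heq : φ =ᶠ[𝓝 t] fun _ => φ t := by
    filter_upwards [h, hmin] with s h₁ h₂ using le_antisymm h₁ h₂
  have : deriv (deriv φ) t = 0 := by simpa using heq.deriv.deriv_eq
  exact hpos.ne' this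

lemma fderiv_fderiv_le_of_max {E : Type*} [NormedAddCommGroup E] [InnerProductSpace ℝ E]
    {f : E → ℝ} (hf : ContDiff ℝ 2 f) {c : ℝ} {x : E}
    (hx : ∀ y, f y - c * ‖y‖ ^ 2 ≤ f x - c * ‖x‖ ^ 2) (v : E) :
    fderiv ℝ (fderiv ℝ f) x v v ≤ 2 * c * ‖v‖ ^ 2 := by
  set φ : ℝ → ℝ := fun t =>
    f (x + t • v) - c * (‖x‖ ^ 2 + 2 * ⟪x, v⟫ * t + ‖v‖ ^ 2 * t ^ 2) with hφ
  have h₁ : ∀ t, HasDerivAt φ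
      (fderiv ℝ f (x + t • v) v - c * (2 * ⟪x, v⟫ + ‖v‖ ^ 2 * (2 * t))) t := by
    intro t
    refine (hasDerivAt_comp_line hf x v t).sub (HasDerivAt.const_mul c ?_)
    have h := (((hasDerivAt_id t).const_mul (2 * ⟪x, v⟫)).const_add (‖x‖ ^ 2)).add
      (((hasDerivAt_id t).pow 2).const_mul (‖v‖ ^ 2))
    exact h.congr_deriv (by simp)
  have h₂ : HasDerivAt (deriv φ)
      (fderiv ℝ (fderiv ℝ f) x v v - c * (‖v‖ ^ 2 * 2)) 0 := by
    rw [funext fun t => (h₁ t).deriv]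
    have h := (hasDerivAt_fderiv_comp_line hf x v 0).sub
      (((((hasDerivAt_id (0 : ℝ)).const_mul 2).const_mul (‖v‖ ^ 2)).const_add
        (2 * ⟪x, v⟫)).const_mul c)
    exact h.congr_deriv (by simp)
  have hmax : IsLocalMax φ 0 := by
    refine Eventually.of_forall fun t => ?_
    have h := hx (x + t • v)
    rw [norm_add_sq_real, real_inner_smul_right, norm_smul, mul_pow, Real.norm_eq_abs,
      sq_abs] at h
    simp only [hφ, zero_smul, add_zero]
    linarith
  have h := hmax.deriv_deriv_nonpos (h₁ 0).continuousAt
  rw [h₂.deriv] at h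
  linarith

lemma QuadDecay.exists_max {n : ℕ} {f : EuclideanSpace ℝ (Fin n) → ℝ} (h : QuadDecay n f)
    (hf : Continuous f) {c : ℝ} (hc : 0 < c) :
    ∃ x, ∀ y, f y - c * ‖y‖ ^ 2 ≤ f x - c * ‖x‖ ^ 2 := by
  refine Continuous.exists_forall_ge' (f := fun y => f y - c * ‖y‖ ^ 2) (by fun_prop) 0 ?_
  have hco : cocompact (EuclideanSpace ℝ (Fin n)) = comap norm atTop := by
    rw [comap_norm_atTop, Metric.cobounded_eq_cocompact]
  rw [hco]
  have hnorm : Tendsto (fun x : EuclideanSpace ℝ (Fin n) => ‖x‖) (comap norm atTop) atTop :=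
    tendsto_comap
  have hsq := (tendsto_pow_atTop (α := ℝ) two_ne_zero).comp hnorm
  filter_upwards [(tendsto_order.1 h).2 (c / 2) (by positivity),
    hsq.eventually_ge_atTop (|f 0| / (c / 2)), hnorm.eventually_gt_atTop 0] with x h₁ h₂ h₃
  rw [div_lt_iff₀ (by positivity)] at h₁
  rw [Function.comp_apply, div_le_iff₀ (by positivity)] at h₂
  simp only [norm_zero]
  linarith [le_abs_self (f x), neg_abs_le (f 0)]

section Hessian

variable {n : ℕ} {f : EuclideanSpace ℝ (Fin n) → ℝ}

lemma hessian_apply (x : EuclideanSpace ℝ (Fin n)) (i j : Fin n) :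
    hessian n f x i j = fderiv ℝ (fderiv ℝ f) x (EuclideanSpace.single i 1)
      (EuclideanSpace.single j 1) := by
  simp [hessian, iteratedFDeriv_two_apply]

lemma EuclideanSpace.sum_smul_single (v : EuclideanSpace ℝ (Fin n)) :
    ∑ i, v i • EuclideanSpace.single i (1 : ℝ) = v := by
  simpa using (EuclideanSpace.basisFun (Fin n) ℝ).sum_repr v

lemma fderiv_fderiv_eq_sum (x v w : EuclideanSpace ℝ (Fin n)) :
    fderiv ℝ (fderiv ℝ f) x v w = ∑ i, ∑ j, v i * hessian n f x i j * w j := by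
  conv_lhs => rw [← EuclideanSpace.sum_smul_single v, ← EuclideanSpace.sum_smul_single w]
  simp only [map_sum, map_smul, _root_.sum_apply, _root_.smul_apply,
    smul_eq_mul, hessian_apply, Finset.mul_sum]
  rw [Finset.sum_comm]
  exact Finset.sum_congr rfl fun i _ => Finset.sum_congr rfl fun j _ => by ring

lemma hessian_posSemidef (hf : ContDiff ℝ 2 f) (hconv : ConvexOn ℝ Set.univ f)
    (x : EuclideanSpace ℝ (Fin n)) : (hessian n f x).PosSemidef := by
  refine .of_dotProduct_mulVec_nonneg ?_ fun w => ?_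
  · ext i j
    rw [Matrix.conjTranspose_apply, star_trivial, hessian_apply, hessian_apply]
    exact (hf.contDiffAt.isSymmSndFDerivAt (by simp)) _ _
  · have h := hconv.fderiv_fderiv_nonneg hf x (WithLp.toLp 2 w)
    rw [fderiv_fderiv_eq_sum] at h
    simpa [dotProduct, Matrix.mulVec, Finset.mul_sum, mul_assoc] using h

lemma continuous_trace_hessian (hf : ContDiff ℝ 2 f) :
    Continuous fun x => (hessian n f x).trace := by
  have h : Continuous (fderiv ℝ (fderiv ℝ f)) :=
    (hf.fderiv_right (m := 1) (by norm_num)).continuous_fderiv (by norm_num)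
  simp only [Matrix.trace, Matrix.diag_apply, hessian_apply]
  fun_prop

/-- A `C²` function with vanishing Hessian is affine. -/
lemma exists_affine_of_hessian_eq_zero (hf : ContDiff ℝ 2 f) (h : ∀ x, hessian n f x = 0) :
    ∃ (c : ℝ) (b : EuclideanSpace ℝ (Fin n)), ∀ x, f x = c + ⟪b, x⟫ := by
  have hd : Differentiable ℝ (fderiv ℝ f) :=
    (hf.fderiv_right (m := 1) (by norm_num)).differentiable (by norm_num)
  have hconst : ∀ x, fderiv ℝ f x = fderiv ℝ f 0 := fun x =>
    is_const_of_fderiv_eq_zero hd (fun y => by ext v w; simp [fderiv_fderiv_eq_sum, h]) x 0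
  have hfd : Differentiable ℝ f := hf.differentiable (by norm_num)
  set L := fderiv ℝ f 0
  refine ⟨f 0, (InnerProductSpace.toDual ℝ _).symm L, fun x => ?_⟩
  rw [InnerProductSpace.toDual_symm_apply]
  have h₀ := is_const_of_fderiv_eq_zero (f := fun y => f y - L y) (𝕜 := ℝ)
    (hfd.sub L.differentiable) (fun y => by
      rw [fderiv_fun_sub (hfd y) L.differentiableAt, hconst y, L.fderiv, sub_self]) x 0
  simp only [map_zero, sub_zero] at h₀
  linarith

end Hessian

/-- Small nonzero positive semidefinite matrices cannot solve the equation: the linear term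
dominates. -/
lemma CondQ.exists_trace_gap {E : Type*} {n : ℕ} (hn : 0 < n) {a : ℕ → E → ℝ} (hQ : CondQ n a)
    (ha1 : ¬ ∀ x, a 1 x = 0) :
    ∃ s : ℝ, 0 < s ∧ ∀ x (A : Matrix (Fin n) (Fin n) ℝ), A.PosSemidef →
      ∑ i ∈ Finset.Icc 1 n, a i x * elemSym n i A = 0 → A.trace ≤ s → A.trace = 0 := by
  obtain ⟨μ, _, hμ, -, hμa⟩ := (hQ 1 (Finset.mem_Icc.2 ⟨le_rfl, hn⟩)).resolve_left ha1
  have hM : ∀ k, ∃ M : ℝ, 0 ≤ M ∧ (k ∈ Finset.Icc 1 n → ∀ x, |a k x| ≤ M) := by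
    intro k
    by_cases hk : k ∈ Finset.Icc 1 n
    · rcases hQ k hk with h | ⟨μ₁, μ₂, h₁, h₁₂, h⟩
      · exact ⟨0, le_rfl, fun _ x => by simp [h x]⟩
      · exact ⟨μ₂, h₁.le.trans h₁₂, fun _ x => (h x).2⟩
    · exact ⟨0, le_rfl, fun h => absurd h hk⟩
  choose M hM₀ hM using hM
  set K : ℝ := ∑ k ∈ Finset.Icc 2 n, M k * n.choose k
  have hK : 0 ≤ K := Finset.sum_nonneg fun k _ => mul_nonneg (hM₀ k) (Nat.cast_nonneg _)
  have hs : 0 < min 1 (μ / (K + 1)) := lt_min one_pos (by positivity)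
  refine ⟨min 1 (μ / (K + 1)), hs, fun x A hA heq htr => ?_⟩
  by_contra hne
  have ht : 0 < A.trace := lt_of_le_of_ne hA.trace_nonneg (Ne.symm hne)
  have ht1 : A.trace ≤ 1 := htr.trans (min_le_left _ _)
  have htK : A.trace * (K + 1) ≤ μ :=
    (le_div_iff₀ (by positivity)).1 (htr.trans (min_le_right _ _))
  have hsplit : Finset.Icc 1 n = insert 1 (Finset.Icc 2 n) := by
    ext k; simp only [Finset.mem_insert, Finset.mem_Icc]; omega
  rw [hsplit, Finset.sum_insert (by simp), elemSym_one hn] at heq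
  have hbound : |∑ k ∈ Finset.Icc 2 n, a k x * elemSym n k A| ≤ A.trace ^ 2 * K := by
    rw [Finset.mul_sum]
    refine (Finset.abs_sum_le_sum_abs _ _).trans (Finset.sum_le_sum fun k hk => ?_)
    obtain ⟨hk2, hkn⟩ := Finset.mem_Icc.1 hk
    have h₁ := hM k (Finset.mem_Icc.2 ⟨by omega, hkn⟩) x
    have h₂ := abs_elemSym_le hkn hA
    calc |a k x * elemSym n k A| ≤ M k * (A.trace ^ k * n.choose k) := by
          rw [abs_mul]; exact mul_le_mul h₁ h₂ (abs_nonneg _) (hM₀ k)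
      _ ≤ M k * (A.trace ^ 2 * n.choose k) := by
          exact mul_le_mul_of_nonneg_left (mul_le_mul_of_nonneg_right
            (pow_le_pow_of_le_one ht.le ht1 hk2) (Nat.cast_nonneg _)) (hM₀ k)
      _ = A.trace ^ 2 * (M k * n.choose k) := by ring
  have h1 : |a 1 x| * A.trace ≤ A.trace ^ 2 * K := by
    rw [← abs_of_pos ht, ← abs_mul, eq_neg_of_add_eq_zero_left heq, abs_neg, abs_of_pos ht]
    exact hbound
  have h2 : μ * A.trace ≤ |a 1 x| * A.trace := mul_le_mul_of_nonneg_right (hμa x).1 ht.le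
  nlinarith [mul_pos ht ht]

/-- Main theorem, second part: if moreover `a_1` is not identically zero, then `f`
is an affine function `f(x) = a + ⟨b, x⟩`. -/
theorem stmt3 (n : ℕ) (hn : 0 < n)
    (f : EuclideanSpace ℝ (Fin n) → ℝ)
    (hf : ContDiff ℝ 2 f)
    (hconv : ConvexOn ℝ Set.univ f)
    (a : ℕ → EuclideanSpace ℝ (Fin n) → ℝ)
    (hacont : ∀ k ∈ Finset.Icc 1 n, Continuous (a k))
    (hQ : CondQ n a)
    (ha1 : ¬ (∀ x, a 1 x = 0))
    (heq : ∀ x, ∑ i ∈ Finset.Icc 1 n, a i x * elemSym n i (hessian n f x) = 0)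
    (hgrowth : QuadDecay n f) :
    ∃ (c : ℝ) (b : EuclideanSpace ℝ (Fin n)), ∀ x, f x = c + ⟪b, x⟫ := by
  obtain ⟨s, hs, hgap⟩ := hQ.exists_trace_gap hn ha1
  have hpsd := hessian_posSemidef hf hconv
  have hzero : ∀ x, (hessian n f x).trace ≤ s → (hessian n f x).trace = 0 := fun x =>
    hgap x _ (hpsd x) (heq x)
  have hn' : (0 : ℝ) < n := Nat.cast_pos.2 hn
  obtain ⟨x₀, hx₀⟩ := hgrowth.exists_max hf.continuous (c := s / (4 * n)) (by positivity)
  have htr₀ : (hessian n f x₀).trace ≤ s / 2 := by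
    calc (hessian n f x₀).trace ≤ ∑ _i : Fin n, 2 * (s / (4 * n)) :=
          Finset.sum_le_sum fun i _ => by
            simpa [hessian_apply] using
              fderiv_fderiv_le_of_max hf hx₀ (EuclideanSpace.single i 1)
      _ = s / 2 := by
          rw [Finset.sum_const, Finset.card_univ, Fintype.card_fin, nsmul_eq_mul]
          field_simp
          norm_num
  refine exists_affine_of_hessian_eq_zero hf fun x => ?_
  have htr : (hessian n f x).trace ≤ s := by
    by_contra! hx
    obtain ⟨y, hy⟩ := mem_range_of_exists_le_of_exists_ge (continuous_trace_hessian hf)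
      ⟨x₀, by linarith⟩ ⟨x, hx.le⟩
    have := hzero y hy.le
    linarith
  exact (hpsd x).trace_eq_zero_iff.1 (hzero x htr)
end

section
/- Let f : ℝⁿ → ℝ be a convex C² (entire) function satisfying det Hess f(x) = 1 for all x ∈ ℝⁿ. Then f is a quadratic polynomial: there exist a ∈ ℝ, b ∈ ℝⁿ, and a constant real n×n matrix A such that f(x) = a + ⟨b, x⟩ + ⟨x, A x⟩ for all x ∈ ℝⁿ. -/
open scoped RealInnerProductSpace

namespace MongeAmpere

open Set Filter Topology MeasureTheory

local notation "𝔼" n => EuclideanSpace ℝ (Fin n)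

/-! ### Linear algebra -/

/-- Arithmetic-geometric mean inequality for positive semidefinite matrices. -/
theorem det_le_trace_pow {n : ℕ} {Y : Matrix (Fin n) (Fin n) ℝ} (hY : Y.PosSemidef) :
    Y.det ≤ (Y.trace / n) ^ n := by
  rcases Nat.eq_zero_or_pos n with rfl | hn
  · simp
  have hn' : (0 : ℝ) < n := by exact_mod_cast hn
  have hdet := hY.isHermitian.det_eq_prod_eigenvalues
  have htr := hY.isHermitian.trace_eq_sum_eigenvalues
  simp only [RCLike.ofReal_real_eq_id, id_eq] at hdet htr
  have hz := hY.eigenvalues_nonneg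
  have h := Real.geom_mean_le_arith_mean_weighted Finset.univ (fun _ : Fin n => (1 / n : ℝ))
    hY.isHermitian.eigenvalues (fun _ _ => by positivity)
    (by simp [hn'.ne']) (fun i _ => hz i)
  rw [hdet, htr]
  have h1 : ∏ i, hY.isHermitian.eigenvalues i =
      (∏ i, hY.isHermitian.eigenvalues i ^ (1 / n : ℝ)) ^ n := by
    rw [← Finset.prod_pow]
    refine Finset.prod_congr rfl fun i _ => ?_
    rw [← Real.rpow_natCast, ← Real.rpow_mul (hz i)]
    simp [hn'.ne']
  rw [h1]
  refine pow_le_pow_left₀ (Finset.prod_nonneg fun i _ => Real.rpow_nonneg (hz i) _) ?_ n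
  refine h.trans (le_of_eq ?_)
  rw [Finset.sum_div]
  exact Finset.sum_congr rfl fun i _ => by ring

/-- A family `b` adapted to the positive operator `A` of determinant one: it behaves like an
`A`-orthonormal basis of unit volume. -/
structure IsFrame {n : ℕ} (A : (𝔼 n) →L[ℝ] 𝔼 n) (b : Fin n → 𝔼 n) : Prop where
  sum_self : ∑ i, ⟪A (b i), b i⟫ = n
  det_le : ∀ X : (𝔼 n) →L[ℝ] 𝔼 n, X.IsPositive → X.det ≤ ((∑ i, ⟪X (b i), b i⟫) / n) ^ n
  norm_sq_le : ∀ Λ : ℝ, (∀ ξ, ⟪A ξ, ξ⟫ ≤ Λ * ‖ξ‖ ^ 2) →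
    ∀ w, ‖w‖ ^ 2 ≤ Λ * ∑ i, ⟪w, b i⟫ ^ 2
  eq_zero : ∀ X : (𝔼 n) →L[ℝ] 𝔼 n, X.IsPositive → ∑ i, ⟪X (b i), b i⟫ ≤ 0 → X = 0

theorem exists_isFrame {n : ℕ} {A : (𝔼 n) →L[ℝ] 𝔼 n} (hA : A.IsPositive) (hdet : A.det = 1) :
    ∃ b, IsFrame A b := by
  have hfr : Module.finrank ℝ (𝔼 n) = n := by simp
  have hs : (A : (𝔼 n) →ₗ[ℝ] 𝔼 n).IsSymmetric := hA.isSymmetric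
  set φ := hs.eigenvectorBasis hfr with hφ
  set l := hs.eigenvalues hfr with hl
  have hAφ : ∀ i, A (φ i) = l i • φ i := fun i => by
    exact hs.apply_eigenvectorBasis hfr i
  have hl0 : ∀ i, 0 ≤ l i := fun i => LinearMap.IsPositive.nonneg_eigenvalues hA.toLinearMap hfr i
  have hprod : ∏ i, l i = 1 := by
    have := hs.det_eq_prod_eigenvalues hfr
    rw [← hdet]; symm
    simpa using this
  have hlpos : ∀ i, 0 < l i := fun i => by
    refine lt_of_le_of_ne (hl0 i) fun h => ?_
    rw [Finset.prod_eq_zero (Finset.mem_univ i) h.symm] at hprod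
    norm_num at hprod
  set d : Fin n → ℝ := fun i => (Real.sqrt (l i))⁻¹ with hd
  have hd2 : ∀ i, d i * d i = (l i)⁻¹ := fun i => by
    simp only [hd]; rw [← mul_inv, Real.mul_self_sqrt (hl0 i)]
  have hd0 : ∀ i, d i ≠ 0 := fun i => inv_ne_zero (Real.sqrt_ne_zero'.2 (hlpos i))
  set M : ((𝔼 n) →L[ℝ] 𝔼 n) → Matrix (Fin n) (Fin n) ℝ := fun X =>
    LinearMap.toMatrix φ.toBasis φ.toBasis (X : (𝔼 n) →ₗ[ℝ] 𝔼 n) with hM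
  have hMij : ∀ X i j, M X i j = ⟪φ i, X (φ j)⟫ := fun X i j => by
    simp [hM, LinearMap.toMatrix_apply, OrthonormalBasis.repr_apply_apply]
  set Y : ((𝔼 n) →L[ℝ] 𝔼 n) → Matrix (Fin n) (Fin n) ℝ := fun X =>
    Matrix.diagonal d * M X * Matrix.diagonal d with hYdef
  have hYpos : ∀ X : (𝔼 n) →L[ℝ] 𝔼 n, X.IsPositive → (Y X).PosSemidef := fun X hX => by
    have h1 : (M X).PosSemidef :=
      (LinearMap.posSemidef_toMatrix_iff φ).2 hX.toLinearMap
    have := h1.conjTranspose_mul_mul_same (Matrix.diagonal d)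
    simpa [hYdef, Matrix.diagonal_conjTranspose] using this
  have hYtr : ∀ X : (𝔼 n) →L[ℝ] 𝔼 n,
      (Y X).trace = ∑ i, ⟪X (d i • φ i), d i • φ i⟫ := fun X => by
    simp only [Matrix.trace, Matrix.diag, hYdef, Matrix.diagonal_mul, Matrix.mul_diagonal, hMij,
      map_smul, inner_smul_left, inner_smul_right, conj_trivial]
    refine Finset.sum_congr rfl fun i _ => ?_
    rw [real_inner_comm]; ring
  have hYdet : ∀ X : (𝔼 n) →L[ℝ] 𝔼 n, (Y X).det = X.det := fun X => by
    have h1 : (M X).det = X.det := LinearMap.det_toMatrix φ.toBasis _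
    have h2 : (∏ i, d i) * (∏ i, d i) = 1 := by
      rw [← Finset.prod_mul_distrib]; simp [hd2, hprod]
    simp only [hYdef, Matrix.det_mul, Matrix.det_diagonal, h1]
    linear_combination X.det * h2
  refine ⟨fun i => d i • φ i, ?_, ?_, ?_, ?_⟩
  · have : ∀ i, ⟪A (d i • φ i), d i • φ i⟫ = 1 := fun i => by
      simp only [map_smul, hAφ, inner_smul_left, inner_smul_right, conj_trivial,
        real_inner_self_eq_norm_sq, φ.norm_eq_one]
      have := hd2 i
      have h3 := (hlpos i).ne'
      calc d i * (d i * (l i * 1 ^ 2)) = (d i * d i) * l i := by ring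
        _ = 1 := by rw [this]; exact inv_mul_cancel₀ h3
    rw [Finset.sum_congr rfl fun i _ => this i]; simp
  · intro X hX
    rw [← hYtr, ← hYdet]
    exact det_le_trace_pow (hYpos X hX)
  · intro Λ hΛ w
    rw [← φ.sum_sq_inner_left w, Finset.mul_sum]
    refine Finset.sum_le_sum fun i _ => ?_
    have h1 : l i ≤ Λ := by
      have := hΛ (φ i)
      simpa [hAφ, inner_smul_left, φ.norm_eq_one] using this
    rw [inner_smul_right, mul_pow, sq (d i), hd2, ← mul_assoc]
    have : 1 ≤ Λ * (l i)⁻¹ := by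
      rw [← div_eq_mul_inv, le_div_iff₀ (hlpos i)]; linarith
    nlinarith [sq_nonneg ⟪w, φ i⟫]
  · intro X hX h0
    have hY0 : Y X = 0 := by
      rw [← (hYpos X hX).trace_eq_zero_iff]
      exact le_antisymm ((hYtr X).trans_le h0) (hYpos X hX).trace_nonneg
    have hM0 : M X = 0 := by
      ext i j
      have := congrFun (congrFun hY0 i) j
      simpa [hYdef, hd0 i, hd0 j] using this
    have : (X : (𝔼 n) →ₗ[ℝ] 𝔼 n) = 0 := by
      simpa [hM] using hM0
    ext1 x
    exact congrArg (fun T : (𝔼 n) →ₗ[ℝ] 𝔼 n => T x) this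

variable {n : ℕ}

theorem det_nonneg {A : (𝔼 n) →L[ℝ] 𝔼 n} (hA : A.IsPositive) : 0 ≤ A.det := by
  have hfr : Module.finrank ℝ (𝔼 n) = n := by simp
  have h := hA.isSymmetric.det_eq_prod_eigenvalues hfr
  have h' : A.det = ∏ i, hA.isSymmetric.eigenvalues hfr i := by simpa using h
  rw [h']
  exact Finset.prod_nonneg fun i _ => LinearMap.IsPositive.nonneg_eigenvalues hA.toLinearMap hfr i

/-- A positive operator of determinant one bounded above by `Λ` is bounded below. -/
theorem norm_sq_le_of_det_eq_one {A : (𝔼 n) →L[ℝ] 𝔼 n} (hA : A.IsPositive) (hdet : A.det = 1)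
    {Λ : ℝ} (hΛ : ∀ ξ, ⟪A ξ, ξ⟫ ≤ Λ * ‖ξ‖ ^ 2) (ξ : 𝔼 n) :
    ‖ξ‖ ^ 2 ≤ Λ ^ (n - 1) * ⟪A ξ, ξ⟫ := by
  have hfr : Module.finrank ℝ (𝔼 n) = n := by simp
  have hs : (A : (𝔼 n) →ₗ[ℝ] 𝔼 n).IsSymmetric := hA.isSymmetric
  set φ := hs.eigenvectorBasis hfr with hφ
  set l := hs.eigenvalues hfr with hl
  have hAφ : ∀ i, A (φ i) = l i • φ i := fun i => hs.apply_eigenvectorBasis hfr i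
  have hl0 : ∀ i, 0 ≤ l i := fun i => LinearMap.IsPositive.nonneg_eigenvalues hA.toLinearMap hfr i
  have hprod : ∏ i, l i = 1 := by
    have := hs.det_eq_prod_eigenvalues hfr
    rw [← hdet]; symm
    simpa using this
  have hlΛ : ∀ i, l i ≤ Λ := fun i => by
    have := hΛ (φ i)
    simpa [hAφ, inner_smul_left, φ.norm_eq_one] using this
  have hlow : ∀ i, 1 ≤ Λ ^ (n - 1) * l i := fun i => by
    rw [← hprod, ← Finset.prod_erase_mul _ _ (Finset.mem_univ i)]
    refine mul_le_mul_of_nonneg_right ?_ (hl0 i)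
    refine (Finset.prod_le_prod (fun j _ => hl0 j) fun j _ => hlΛ j).trans (le_of_eq ?_)
    simp [Finset.card_erase_of_mem]
  have hin : ⟪A ξ, ξ⟫ = ∑ i, l i * ⟪ξ, φ i⟫ ^ 2 := by
    rw [← φ.sum_inner_mul_inner (A ξ) ξ]
    refine Finset.sum_congr rfl fun i _ => ?_
    rw [hA.inner_left_eq_inner_right, hAφ, inner_smul_right, real_inner_comm ξ (φ i)]
    ring
  rw [hin, ← φ.sum_sq_inner_left ξ, Finset.mul_sum]
  refine Finset.sum_le_sum fun i _ => ?_
  nlinarith [hlow i, sq_nonneg ⟪ξ, φ i⟫]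

/-! ### Functions with a continuous Hessian -/

/-- `w` is a `C²` function with gradient `g` and Hessian `H`. -/
structure HasHessian (w : (𝔼 n) → ℝ) (g : (𝔼 n) → 𝔼 n) (H : (𝔼 n) → (𝔼 n) →L[ℝ] 𝔼 n) :
    Prop where
  grad : ∀ x, HasFDerivAt w (innerSL ℝ (g x)) x
  hess : ∀ x, HasFDerivAt g (H x) x
  cont : Continuous H

namespace HasHessian

variable {w w' : (𝔼 n) → ℝ} {g g' : (𝔼 n) → 𝔼 n} {H H' : (𝔼 n) → (𝔼 n) →L[ℝ] 𝔼 n}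

theorem continuous (h : HasHessian w g H) : Continuous w :=
  continuous_iff_continuousAt.2 fun x => (h.grad x).continuousAt

theorem continuous_grad (h : HasHessian w g H) : Continuous g :=
  continuous_iff_continuousAt.2 fun x => (h.hess x).continuousAt

theorem hasDerivAt_line (h : HasHessian w g H) (x ξ : 𝔼 n) (t : ℝ) :
    HasDerivAt (fun t : ℝ => w (x + t • ξ)) ⟪g (x + t • ξ), ξ⟫ t := by
  have h1 : HasDerivAt (fun t : ℝ => x + t • ξ) ξ t := by
    simpa using ((hasDerivAt_id t).smul_const ξ).const_add x
  have h2 := (h.grad (x + t • ξ)).comp_hasDerivAt t h1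
  exact h2

theorem hasDerivAt_line_grad (h : HasHessian w g H) (x ξ η : 𝔼 n) (t : ℝ) :
    HasDerivAt (fun t : ℝ => ⟪g (x + t • ξ), η⟫) ⟪H (x + t • ξ) ξ, η⟫ t := by
  have h1 : HasDerivAt (fun t : ℝ => x + t • ξ) ξ t := by
    simpa using ((hasDerivAt_id t).smul_const ξ).const_add x
  have h2 := (h.hess (x + t • ξ)).comp_hasDerivAt t h1
  simpa using h2.inner ℝ (hasDerivAt_const t η)

theorem symm (h : HasHessian w g H) (x ξ η : 𝔼 n) : ⟪H x ξ, η⟫ = ⟪ξ, H x η⟫ := by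
  let L : (𝔼 n) →L[ℝ] (𝔼 n) →L[ℝ] ℝ := LinearMap.toContinuousLinearMap
    { toFun := fun v => innerSL ℝ v
      map_add' := fun v v' => map_add _ v v'
      map_smul' := fun c v => by ext; simp }
  have h1 : ∀ y, HasFDerivAt w (L (g y)) y := h.grad
  have h2 : HasFDerivAt (fun y => L (g y)) (L.comp (H x)) x := L.hasFDerivAt.comp x (h.hess x)
  have := second_derivative_symmetric h1 h2 ξ η
  rw [real_inner_comm (H x η)]
  exact this

theorem add (h : HasHessian w g H) (h' : HasHessian w' g' H') :
    HasHessian (fun x => w x + w' x) (fun x => g x + g' x) (fun x => H x + H' x) where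
  grad x := by
    rw [map_add]; exact (h.grad x).add (h'.grad x)
  hess x := (h.hess x).add (h'.hess x)
  cont := h.cont.add h'.cont

theorem const_smul (h : HasHessian w g H) (c : ℝ) :
    HasHessian (fun x => c * w x) (fun x => c • g x) (fun x => c • H x) where
  grad x := by
    refine ((h.grad x).const_smul c).congr_fderiv ?_
    ext; simp
  hess x := (h.hess x).const_smul c
  cont := h.cont.const_smul c

theorem affine (c : ℝ) (p : 𝔼 n) :
    HasHessian (fun x => c + ⟪p, x⟫) (fun _ => p) (fun _ => (0 : (𝔼 n) →L[ℝ] 𝔼 n)) where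
  grad x := by
    exact (innerSL ℝ p).hasFDerivAt.const_add c
  hess x := hasFDerivAt_const p x
  cont := continuous_const

theorem comp_affine (h : HasHessian w g H) (x₀ : 𝔼 n) (A : (𝔼 n) →L[ℝ] 𝔼 n) :
    HasHessian (fun y => w (x₀ + A y)) (fun y => A.adjoint (g (x₀ + A y)))
      (fun y => A.adjoint ∘L H (x₀ + A y) ∘L A) where
  grad y := by
    have h1 : HasFDerivAt (fun y => x₀ + A y) A y := A.hasFDerivAt.const_add x₀
    have h2 := (h.grad (x₀ + A y)).comp y h1
    refine h2.congr_fderiv ?_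
    ext1 ξ
    simp [ContinuousLinearMap.adjoint_inner_left]
  hess y := by
    have h1 : HasFDerivAt (fun y => x₀ + A y) A y := A.hasFDerivAt.const_add x₀
    exact A.adjoint.hasFDerivAt.comp y ((h.hess (x₀ + A y)).comp y h1)
  cont := by
    have : Continuous fun y => H (x₀ + A y) := h.cont.comp (by fun_prop)
    exact continuous_const.clm_comp (this.clm_comp continuous_const)

theorem comp_add (h : HasHessian w g H) (a : 𝔼 n) :
    HasHessian (fun x => w (x + a)) (fun x => g (x + a)) (fun x => H (x + a)) where
  grad x := by
    have h1 : HasFDerivAt (fun y => y + a) (ContinuousLinearMap.id ℝ (𝔼 n)) x :=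
      (hasFDerivAt_id x).add_const a
    exact (h.grad (x + a)).comp x h1
  hess x := by
    have h1 : HasFDerivAt (fun y => y + a) (ContinuousLinearMap.id ℝ (𝔼 n)) x :=
      (hasFDerivAt_id x).add_const a
    exact (h.hess (x + a)).comp x h1
  cont := h.cont.comp (by fun_prop)

/-- First order necessary condition. -/
theorem grad_eq_zero (h : HasHessian w g H) {x : 𝔼 n} (hx : IsLocalMin w x) : g x = 0 := by
  have := hx.hasFDerivAt_eq_zero (h.grad x)
  simpa using congrArg (fun T : (𝔼 n) →L[ℝ] ℝ => T (g x)) this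

/-- Second order necessary condition. -/
theorem isPositive_of_isLocalMin (h : HasHessian w g H) {x : 𝔼 n} (hx : IsLocalMin w x) :
    (H x).IsPositive := by
  rw [ContinuousLinearMap.isPositive_iff]
  refine ⟨fun ξ η => h.symm x ξ η, fun ξ => ?_⟩
  by_contra! hneg
  set φ : ℝ → ℝ := fun t => w (x + t • ξ) with hφ
  have hd : deriv φ = fun t => ⟪g (x + t • ξ), ξ⟫ :=
    funext fun t => (h.hasDerivAt_line x ξ t).deriv
  have hdd : deriv (deriv φ) 0 = ⟪H x ξ, ξ⟫ := by
    rw [hd]; simpa using (h.hasDerivAt_line_grad x ξ ξ 0).deriv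
  have hmin : IsLocalMin φ 0 := by
    have hc : ContinuousAt (fun t : ℝ => x + t • ξ) 0 := by fun_prop
    have := hc.tendsto
    simp only [zero_smul, add_zero] at this
    simpa [IsLocalMin, IsMinFilter, hφ] using this.eventually hx
  have hmax : IsLocalMax φ 0 := by
    refine isLocalMax_of_deriv_deriv_neg (by rw [hdd]; exact hneg) ?_
      (h.hasDerivAt_line x ξ 0).continuousAt
    exact hmin.deriv_eq_zero
  have hconst : φ =ᶠ[𝓝 0] fun _ => φ 0 := by
    filter_upwards [hmin, hmax] with t h1 h2 using le_antisymm h2 h1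
  have := hconst.deriv.deriv_eq
  simp [hdd] at this
  linarith

end HasHessian

/-- **Alexandrov's maximum principle**: slopes of supporting planes from below at points of `Γ`
fill no more volume than `Γ`, provided the Hessian has determinant at most one wherever it is
positive. -/
theorem volume_slopes_le {w : (𝔼 n) → ℝ} {g : (𝔼 n) → 𝔼 n} {H : (𝔼 n) → (𝔼 n) →L[ℝ] 𝔼 n}
    (h : HasHessian w g H) (hdet : ∀ x, (H x).IsPositive → (H x).det ≤ 1)
    {Γ P : Set (𝔼 n)} (hΓ : MeasurableSet Γ)
    (hP : ∀ p ∈ P, ∃ x ∈ Γ, IsLocalMin (fun y => w y - ⟪p, y⟫) x) :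
    volume P ≤ volume Γ := by
  set S : Set (𝔼 n) := Γ ∩ {x | |(H x).det| ≤ 1} with hS
  have hSm : MeasurableSet S := by
    refine hΓ.inter (IsClosed.measurableSet ?_)
    exact isClosed_le (ContinuousLinearMap.continuous_det.comp h.cont).abs continuous_const
  have hsub : P ⊆ g '' S := by
    intro p hp
    obtain ⟨x, hxΓ, hx⟩ := hP p hp
    have h' := h.add (HasHessian.affine 0 (-p))
    have hx' : IsLocalMin (fun y => w y + (0 + ⟪-p, y⟫)) x := by
      simpa [sub_eq_add_neg] using hx
    have hpos := h'.isPositive_of_isLocalMin hx'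
    have hgr := h'.grad_eq_zero hx'
    simp only [add_zero] at hpos
    refine ⟨x, ⟨hxΓ, ?_⟩, ?_⟩
    · simpa [abs_of_nonneg (det_nonneg hpos)] using hdet x hpos
    · simpa [add_neg_eq_zero] using hgr
  calc volume P ≤ volume (g '' S) := measure_mono hsub
    _ ≤ ∫⁻ x in S, ENNReal.ofReal |(H x).det| :=
        addHaar_image_le_lintegral_abs_det_fderiv volume hSm
          fun x _ => (h.hess x).hasFDerivWithinAt
    _ ≤ ∫⁻ x in S, 1 := by
        refine setLIntegral_mono measurable_const fun x hx => ?_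
        exact ENNReal.ofReal_le_one.2 hx.2
    _ ≤ volume Γ := by
        rw [setLIntegral_one]; exact measure_mono inter_subset_left

theorem det_comp (A B : (𝔼 n) →L[ℝ] 𝔼 n) : (A ∘L B).det = A.det * B.det := by
  simp [ContinuousLinearMap.det]

theorem det_smul (c : ℝ) (A : (𝔼 n) →L[ℝ] 𝔼 n) : (c • A).det = c ^ n * A.det := by
  simp [ContinuousLinearMap.det]

theorem det_adjoint (A : (𝔼 n) →L[ℝ] 𝔼 n) : A.adjoint.det = A.det := by
  have h := LinearMap.toMatrix_adjoint (EuclideanSpace.basisFun (Fin n) ℝ)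
    (EuclideanSpace.basisFun (Fin n) ℝ) (A : (𝔼 n) →ₗ[ℝ] 𝔼 n)
  have h2 := congrArg Matrix.det h
  rw [Matrix.det_conjTranspose, LinearMap.det_toMatrix, LinearMap.det_toMatrix] at h2
  simp only [star_trivial] at h2
  exact h2

theorem det_id_add_smulRight (e v : 𝔼 n) :
    (ContinuousLinearMap.id ℝ (𝔼 n) + (innerSL ℝ e).smulRight v).det = 1 + ⟪e, v⟫ := by
  have := LinearMap.transvection.det (innerSL ℝ e : (𝔼 n) →ₗ[ℝ] ℝ) v
  rw [ContinuousLinearMap.coe_coe, innerSL_apply_apply] at this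
  rw [← this]
  rfl

/-- Operators with `0 ≤ X ≤ s` have determinant at most `s ^ n`. -/
theorem det_le_pow {X : (𝔼 n) →L[ℝ] 𝔼 n} (hX : X.IsPositive) {s : ℝ}
    (h : ∀ ξ, ⟪X ξ, ξ⟫ ≤ s * ‖ξ‖ ^ 2) : X.det ≤ s ^ n := by
  obtain ⟨b, hb⟩ := exists_isFrame (A := (1 : (𝔼 n) →L[ℝ] 𝔼 n))
    ContinuousLinearMap.isPositive_one (by simp [ContinuousLinearMap.det])
  refine (hb.det_le X hX).trans ?_
  rcases Nat.eq_zero_or_pos n with rfl | hn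
  · simp
  have hn' : (0 : ℝ) < n := by exact_mod_cast hn
  refine pow_le_pow_left₀ (div_nonneg (Finset.sum_nonneg fun i _ => hX.inner_nonneg_left _)
    hn'.le) ?_ n
  rw [div_le_iff₀ hn', ← hb.sum_self, Finset.mul_sum]
  refine Finset.sum_le_sum fun i _ => (h _).trans (le_of_eq ?_)
  simp

/-- Entire solutions `u` of the Monge-Ampère equation, with gradient `g` and Hessian `H`;
convexity is expressed by the supporting planes. -/
structure Solution (u : (𝔼 n) → ℝ) (g : (𝔼 n) → 𝔼 n) (H : (𝔼 n) → (𝔼 n) →L[ℝ] 𝔼 n) : Prop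
    extends HasHessian u g H where
  tangent_le : ∀ z x, u z + ⟪g z, x - z⟫ ≤ u x
  det_eq : ∀ x, (H x).det = 1

/-- The gap at `x` between `u` and its supporting plane at `z`. -/
noncomputable def gap (u : (𝔼 n) → ℝ) (g : (𝔼 n) → 𝔼 n) (z x : 𝔼 n) : ℝ := u x - u z - ⟪g z, x - z⟫

/-- The normalization of `u` at `x₀` through the linear map `A` at height `r`. -/
noncomputable def rescale (u : (𝔼 n) → ℝ) (g : (𝔼 n) → 𝔼 n) (x₀ : 𝔼 n) (A : (𝔼 n) →L[ℝ] 𝔼 n)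
    (r : ℝ) (y : 𝔼 n) : ℝ := r⁻¹ * gap u g x₀ (x₀ + A y)

/-- The gradient of `rescale`. -/
noncomputable def rescaleGrad (g : (𝔼 n) → 𝔼 n) (x₀ : 𝔼 n) (A : (𝔼 n) →L[ℝ] 𝔼 n)
    (r : ℝ) (y : 𝔼 n) : 𝔼 n := r⁻¹ • A.adjoint (g (x₀ + A y) - g x₀)

/-- The Hessian of `rescale`. -/
noncomputable def rescaleHess (H : (𝔼 n) → (𝔼 n) →L[ℝ] 𝔼 n) (x₀ : 𝔼 n) (A : (𝔼 n) →L[ℝ] 𝔼 n)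
    (r : ℝ) (y : 𝔼 n) : (𝔼 n) →L[ℝ] 𝔼 n := r⁻¹ • (A.adjoint ∘L H (x₀ + A y) ∘L A)

section gap

variable {u : (𝔼 n) → ℝ} {g : (𝔼 n) → 𝔼 n}

@[simp] theorem gap_self (z : 𝔼 n) : gap u g z z = 0 := by simp [gap]

theorem gap_eq_of_grad_eq_zero {z : 𝔼 n} (h : u z = 0) (h' : g z = 0) (x : 𝔼 n) :
    gap u g z x = u x := by simp [gap, h, h']

theorem gap_rescale (x₀ : 𝔼 n) (A : (𝔼 n) →L[ℝ] 𝔼 n) (r : ℝ) (z x : 𝔼 n) :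
    gap (rescale u g x₀ A r) (rescaleGrad g x₀ A r) z x =
      r⁻¹ * gap u g (x₀ + A z) (x₀ + A x) := by
  simp only [gap, rescale, rescaleGrad, inner_smul_left, ContinuousLinearMap.adjoint_inner_left,
    inner_sub_left, inner_sub_right, inner_add_right, map_sub, conj_trivial]
  ring

@[simp] theorem rescale_zero (x₀ : 𝔼 n) (A : (𝔼 n) →L[ℝ] 𝔼 n) (r : ℝ) :
    rescale u g x₀ A r 0 = 0 := by simp [rescale]

@[simp] theorem rescaleGrad_zero (x₀ : 𝔼 n) (A : (𝔼 n) →L[ℝ] 𝔼 n) (r : ℝ) :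
    rescaleGrad g x₀ A r 0 = 0 := by simp [rescaleGrad]

end gap

namespace Solution

variable {u : (𝔼 n) → ℝ} {g : (𝔼 n) → 𝔼 n} {H : (𝔼 n) → (𝔼 n) →L[ℝ] 𝔼 n}

theorem gap_nonneg (h : Solution u g H) (z x : 𝔼 n) : 0 ≤ gap u g z x := by
  have := h.tangent_le z x; simp only [gap]; linarith

theorem nonneg (h : Solution u g H) (h0 : u 0 = 0) (h0' : g 0 = 0) (x : 𝔼 n) : 0 ≤ u x := by
  simpa [h0, h0'] using h.tangent_le 0 x

theorem hasHessian_gap (h : Solution u g H) (z : 𝔼 n) :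
    HasHessian (gap u g z) (fun x => g x - g z) H := by
  have := h.toHasHessian.add (HasHessian.affine (⟪g z, z⟫ - u z) (-g z))
  convert this using 1
  · ext x; simp only [gap, inner_sub_right, inner_neg_left]; ring
  · ext1 x; simp [sub_eq_add_neg]
  · ext1 x; simp

theorem isPositive (h : Solution u g H) (x : 𝔼 n) : (H x).IsPositive :=
  (h.hasHessian_gap x).isPositive_of_isLocalMin
    (Eventually.of_forall fun y => by simpa using h.gap_nonneg x y)

theorem rescale (h : Solution u g H) (x₀ : 𝔼 n) {A : (𝔼 n) →L[ℝ] 𝔼 n} {r : ℝ} (hr : 0 < r)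
    (hA : A.det ^ 2 = r ^ n) :
    Solution (rescale u g x₀ A r) (rescaleGrad g x₀ A r) (rescaleHess H x₀ A r) where
  toHasHessian := by
    have := ((h.hasHessian_gap x₀).comp_affine x₀ A).const_smul r⁻¹
    exact this
  tangent_le z x := by
    have h1 := gap_rescale (u := u) (g := g) x₀ A r z x
    have h2 := mul_nonneg (inv_nonneg.2 hr.le) (h.gap_nonneg (x₀ + A z) (x₀ + A x))
    rw [← h1] at h2
    simp only [gap] at h2
    linarith
  det_eq x := by
    rw [rescaleHess, det_smul, det_comp, det_comp, det_adjoint, h.det_eq, one_mul, ← sq, hA,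
      ← mul_pow, inv_mul_cancel₀ hr.ne', one_pow]

theorem convexOn (h : Solution u g H) : ConvexOn ℝ univ u := by
  refine ⟨convex_univ, fun x _ y _ a b ha hb hab => ?_⟩
  have h1 := h.tangent_le (a • x + b • y) x
  have h2 := h.tangent_le (a • x + b • y) y
  have h3 : a * ⟪g (a • x + b • y), x - (a • x + b • y)⟫ +
      b * ⟪g (a • x + b • y), y - (a • x + b • y)⟫ = 0 := by
    rw [← inner_smul_right, ← inner_smul_right, ← inner_add_right]
    have : a • (x - (a • x + b • y)) + b • (y - (a • x + b • y)) = 0 := by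
      obtain rfl : b = 1 - a := by linarith
      module
    rw [this, inner_zero_right]
  simp only [smul_eq_mul]
  have h4 : u (a • x + b • y) = a * u (a • x + b • y) + b * u (a • x + b • y) := by
    rw [← add_mul, hab, one_mul]
  linarith [mul_le_mul_of_nonneg_left h1 ha, mul_le_mul_of_nonneg_left h2 hb]

theorem continuous_gap (h : Solution u g H) (z : 𝔼 n) : Continuous (gap u g z) :=
  (h.hasHessian_gap z).continuous

end Solution

/-! ### Supersolutions of the linearized equation -/

/-- `Hv` is the Hessian of a supersolution of the equation linearized at a solution with
Hessian `H`. -/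
def IsSuper (H Hv : (𝔼 n) → (𝔼 n) →L[ℝ] 𝔼 n) : Prop :=
  ∀ x b, IsFrame (H x) b → ∑ i, ⟪Hv x (b i), b i⟫ ≤ 0

theorem IsSuper.det_add_le {u : (𝔼 n) → ℝ} {g : (𝔼 n) → 𝔼 n} {H Hv : (𝔼 n) → (𝔼 n) →L[ℝ] 𝔼 n}
    (hv : IsSuper H Hv) (h : Solution u g H) {s : ℝ} (hs : 0 ≤ s) (x : 𝔼 n)
    (hpos : (H x + s • Hv x).IsPositive) : (H x + s • Hv x).det ≤ 1 := by
  obtain ⟨b, hb⟩ := exists_isFrame (h.isPositive x) (h.det_eq x)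
  refine (hb.det_le _ hpos).trans ?_
  have h0 : 0 ≤ ∑ i, ⟪(H x + s • Hv x) (b i), b i⟫ :=
    Finset.sum_nonneg fun i _ => hpos.inner_nonneg_left _
  have h1 : ∑ i, ⟪(H x + s • Hv x) (b i), b i⟫ ≤ n := by
    simp only [add_apply, smul_apply, inner_add_left,
      inner_smul_left, conj_trivial, Finset.sum_add_distrib, hb.sum_self, ← Finset.mul_sum]
    nlinarith [hv x b hb]
  exact pow_le_one₀ (by positivity) (div_le_one_of_le₀ h1 (by positivity))

theorem IsFrame.le_sum {A B : (𝔼 n) →L[ℝ] 𝔼 n} {b : Fin n → 𝔼 n} (hb : IsFrame A b)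
    (hB : B.IsPositive) (hdet : B.det = 1) : (n : ℝ) ≤ ∑ i, ⟪B (b i), b i⟫ := by
  rcases Nat.eq_zero_or_pos n with rfl | hn
  · simp
  have hn' : (0 : ℝ) < n := by exact_mod_cast hn
  have h1 := hb.det_le B hB
  rw [hdet] at h1
  have h0 : 0 ≤ ∑ i, ⟪B (b i), b i⟫ := Finset.sum_nonneg fun i _ => hB.inner_nonneg_left _
  by_contra! hlt
  exact absurd h1 (not_le.2 (pow_lt_one₀ (by positivity) ((div_lt_one hn').2 hlt)
    (Nat.pos_iff_ne_zero.1 hn)))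

/-- Second differences. -/
def diff2 (u : (𝔼 n) → ℝ) (e x : 𝔼 n) : ℝ := u (x + e) + u (x - e) - 2 * u x

namespace Solution

variable {u : (𝔼 n) → ℝ} {g : (𝔼 n) → 𝔼 n} {H : (𝔼 n) → (𝔼 n) →L[ℝ] 𝔼 n}

theorem diff2_nonneg (h : Solution u g H) (e x : 𝔼 n) : 0 ≤ diff2 u e x := by
  have h1 := h.tangent_le x (x + e)
  have h2 := h.tangent_le x (x - e)
  simp only [add_sub_cancel_left, sub_sub_cancel_left, inner_neg_right] at h1 h2
  simp only [diff2]; linarith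

theorem continuous_diff2 (h : Solution u g H) (e : 𝔼 n) : Continuous (diff2 u e) := by
  have := h.continuous
  unfold diff2; fun_prop

/-- A constant minus a second difference of a solution is a supersolution. -/
theorem exists_isSuper_sub_diff2 (h : Solution u g H) (m : ℝ) {c : ℝ} (hc : 0 ≤ c) (e : 𝔼 n) :
    ∃ gv Hv, HasHessian (fun x => m - c * diff2 u e x) gv Hv ∧ IsSuper H Hv := by
  have h0 := h.toHasHessian
  have key := ((((h0.comp_add e).add (h0.comp_add (-e))).add (h0.const_smul (-2))).const_smul
    (-c)).add (HasHessian.affine m 0)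
  have heq : (fun x => m - c * diff2 u e x) =
      fun x => -c * (u (x + e) + u (x + -e) + -2 * u x) + (m + ⟪(0 : 𝔼 n), x⟫) := by
    ext x; simp only [diff2, sub_eq_add_neg, inner_zero_left]; ring
  rw [heq]
  refine ⟨_, _, key, ?_⟩
  · intro x b hb
    have h1 := hb.le_sum (h.isPositive (x + e)) (h.det_eq _)
    have h2 := hb.le_sum (h.isPositive (x + -e)) (h.det_eq _)
    simp only [add_apply, smul_apply, inner_add_left,
      inner_smul_left, conj_trivial, Finset.sum_add_distrib, hb.sum_self, ← Finset.mul_sum,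
      zero_apply, inner_zero_left, Finset.sum_const_zero]
    nlinarith

end Solution

theorem HasHessian.norm_sq (c : 𝔼 n) (s : ℝ) :
    HasHessian (fun y => s / 2 * ‖y - c‖ ^ 2) (fun y => s • (y - c))
      (fun _ => s • ContinuousLinearMap.id ℝ (𝔼 n)) where
  grad y := by
    have h := ((hasFDerivAt_id y).sub_const c).norm_sq.const_mul (s / 2)
    refine h.congr_fderiv ?_
    ext1 ξ
    simp; ring
  hess y := ((hasFDerivAt_id y).sub_const c).const_smul s
  cont := continuous_const

/-- A linear map sending a ball into a sublevel set of a nonnegative solution has a controlled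
determinant. -/
theorem Solution.det_sq_le {u : (𝔼 n) → ℝ} {g : (𝔼 n) → 𝔼 n} {H : (𝔼 n) → (𝔼 n) →L[ℝ] 𝔼 n}
    (h : Solution u g H) (h0 : ∀ x, 0 ≤ u x) {B : (𝔼 n) →L[ℝ] 𝔼 n} {c : 𝔼 n} {ρ r : ℝ}
    (hρ : 0 < ρ) (hr : 0 < r) (hB : ∀ y ∈ Metric.closedBall c ρ, u (B y) ≤ r) :
    B.det ^ 2 ≤ (3 * r / ρ ^ 2) ^ n := by
  set s := 3 * r / ρ ^ 2 with hs
  have hF := (HasHessian.norm_sq c s).add ((h.toHasHessian.comp_affine 0 B).const_smul (-1))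
  set F : (𝔼 n) → ℝ := fun x => s / 2 * ‖x - c‖ ^ 2 + -1 * u (0 + B x) with hFdef
  obtain ⟨y, hy, hmin⟩ := (isCompact_closedBall c ρ).exists_isMinOn
    ⟨c, Metric.mem_closedBall_self hρ.le⟩ hF.continuous.continuousOn
  have hc : F y ≤ 0 := by
    refine (hmin (Metric.mem_closedBall_self hρ.le)).trans ?_
    simp [hFdef, h0]
  have hlt : dist y c < ρ := by
    refine lt_of_le_of_ne hy fun heq => ?_
    have h1 := hB y hy
    rw [dist_eq_norm] at heq
    simp only [hFdef, heq, zero_add] at hc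
    have : s / 2 * ρ ^ 2 = 3 * r / 2 := by rw [hs]; field_simp
    linarith
  have hloc : IsLocalMin F y :=
    hmin.isLocalMin
      (mem_of_superset (Metric.isOpen_ball.mem_nhds hlt) Metric.ball_subset_closedBall)
  have hpos := hF.isPositive_of_isLocalMin hloc
  have hX : (B.adjoint ∘L H (0 + B y) ∘L B).IsPositive := (h.isPositive _).adjoint_conj B
  have := det_le_pow hX (s := s) fun ξ => by
    have := hpos.inner_nonneg_left ξ
    simp only [add_apply, smul_apply, inner_add_left, inner_smul_left, conj_trivial,
      ContinuousLinearMap.id_apply, real_inner_self_eq_norm_sq] at this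
    linarith
  rwa [det_comp, det_comp, det_adjoint, h.det_eq, one_mul, ← sq] at this

/-- A convex set containing a ball around the origin and a point `p` contains a linear image of
the unit ball whose size is proportional to `‖p‖`. -/
theorem exists_map_of_convex {S : Set (𝔼 n)} (hS : Convex ℝ S) {σ : ℝ} (hσ : 0 < σ)
    (hball : Metric.closedBall 0 σ ⊆ S) {p : 𝔼 n} (hp : p ∈ S) (hp0 : p ≠ 0) :
    ∃ (B : (𝔼 n) →L[ℝ] 𝔼 n) (c : 𝔼 n), B.det = (σ / 2) ^ n * (‖p‖ / (2 * σ)) ∧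
      ∀ y ∈ Metric.closedBall c 1, B y ∈ S := by
  have hL : 0 < ‖p‖ := norm_pos_iff.2 hp0
  set e : 𝔼 n := ‖p‖⁻¹ • p with he
  have hen : ‖e‖ = 1 := by simp [he, norm_smul, hL.ne']
  have hee : ⟪e, e⟫ = 1 := by rw [real_inner_self_eq_norm_sq, hen, one_pow]
  have hpe : p = ‖p‖ • e := by rw [he, smul_smul, mul_inv_cancel₀ hL.ne', one_smul]
  have h0 : (0 : 𝔼 n) ∈ S := hball (Metric.mem_closedBall_self hσ.le)
  refine ⟨(σ / 2) • (ContinuousLinearMap.id ℝ (𝔼 n) +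
    (innerSL ℝ e).smulRight ((‖p‖ / (2 * σ) - 1) • e)), e, ?_, fun y hy => ?_⟩
  · rw [det_smul, det_id_add_smulRight, inner_smul_right, hee]; ring
  · set w := y - e with hw
    have hwn : ‖w‖ ≤ 1 := by simpa [dist_eq_norm] using hy
    set a := ⟪e, w⟫ with ha
    have ha1 : |a| ≤ 1 := by
      refine (abs_real_inner_le_norm e w).trans ?_
      rw [hen, one_mul]; exact hwn
    obtain ⟨ha2, ha3⟩ := abs_le.1 ha1
    have hy' : y = e + w := by rw [hw]; abel
    have h1 : σ • (w - a • e) ∈ S := by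
      refine hball ?_
      rw [mem_closedBall_zero_iff, norm_smul, Real.norm_of_nonneg hσ.le]
      have : ‖w - a • e‖ ^ 2 ≤ 1 := by
        rw [norm_sub_sq_real, inner_smul_right, norm_smul, hen, real_inner_comm, ← ha,
          Real.norm_eq_abs, mul_one, sq_abs]
        nlinarith [norm_nonneg w]
      have : ‖w - a • e‖ ≤ 1 := by nlinarith [norm_nonneg (w - a • e)]
      nlinarith
    have h2 : ((1 + a) / 2) • p ∈ S :=
      hS.smul_mem_of_zero_mem h0 hp ⟨by linarith, by linarith⟩
    have h3 := hS h1 h2 (by norm_num : (0 : ℝ) ≤ 1 / 2) (by norm_num : (0 : ℝ) ≤ 1 / 2)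
      (by norm_num)
    convert h3 using 1
    have hin : ⟪e, y⟫ = 1 + a := by rw [hy', inner_add_right, hee]
    simp only [smul_apply, add_apply, ContinuousLinearMap.id_apply,
      ContinuousLinearMap.smulRight_apply, innerSL_apply_apply, hin]
    nth_rw 2 [hpe]
    rw [hy']
    have h5 : (σ / 2) * ((1 + a) * (‖p‖ / (2 * σ) - 1)) =
      (1 / 2) * (((1 + a) / 2) * ‖p‖) - (σ / 2) * (1 + a) := by field_simp
    simp only [smul_add, smul_sub, smul_smul, h5]
    module

/-- The points of a small ball around the barycenter have nonnegative coordinates of sum at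
most one. -/
theorem exists_ball_subset_simplex (hn : 0 < n) : ∃ c : 𝔼 n,
    ∀ y ∈ Metric.closedBall c (1 / (2 * n)), (∀ i, 0 ≤ y i) ∧ ∑ i, y i ≤ 1 := by
  have hn' : (0 : ℝ) < n := by exact_mod_cast hn
  refine ⟨WithLp.toLp 2 fun _ => 1 / (2 * n), fun y hy => ?_⟩
  have hy' : ∀ i, |y i - 1 / (2 * n)| ≤ 1 / (2 * n) := fun i => by
    have h1 := PiLp.norm_apply_le (y - WithLp.toLp 2 fun _ => (1 / (2 * n) : ℝ)) i
    rw [Metric.mem_closedBall, dist_eq_norm] at hy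
    simpa using h1.trans hy
  refine ⟨fun i => by linarith [(abs_le.1 (hy' i)).1], ?_⟩
  calc ∑ i, y i ≤ ∑ _i : Fin n, (1 / n : ℝ) :=
        Finset.sum_le_sum fun i _ => by
          have h1 := (abs_le.1 (hy' i)).2
          have h2 : (1 / n : ℝ) = 1 / (2 * n) + 1 / (2 * n) := by field_simp; norm_num
          linarith
    _ = 1 := by simp [hn'.ne']

namespace Solution

variable {u : (𝔼 n) → ℝ} {g : (𝔼 n) → 𝔼 n} {H : (𝔼 n) → (𝔼 n) →L[ℝ] 𝔼 n}

theorem exists_closedBall_subset (h : Solution u g H) (h0 : u 0 = 0) {r : ℝ} (hr : 0 < r) :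
    ∃ σ > 0, ∀ x ∈ Metric.closedBall (0 : 𝔼 n) σ, u x ≤ r := by
  have : {x | u x < r} ∈ 𝓝 (0 : 𝔼 n) :=
    (isOpen_lt h.continuous continuous_const).mem_nhds (by simpa [h0] using hr)
  obtain ⟨σ, hσ, hs⟩ := Metric.nhds_basis_closedBall.mem_iff.1 this
  exact ⟨σ, hσ, fun x hx => (hs hx).le⟩

theorem exists_norm_le (h : Solution u g H) (h0 : u 0 = 0) (h0' : g 0 = 0) {r : ℝ} (hr : 0 < r) :
    ∃ R, ∀ x, u x ≤ r → ‖x‖ ≤ R := by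
  obtain ⟨σ, hσ, hball⟩ := h.exists_closedBall_subset h0 hr
  refine ⟨Real.sqrt ((3 * r / 1 ^ 2) ^ n / ((σ / 2) ^ n * (1 / (2 * σ))) ^ 2), fun x hx => ?_⟩
  rcases eq_or_ne x 0 with rfl | hx0
  · simp
  have hconv : Convex ℝ {x | u x ≤ r} := by simpa using h.convexOn.convex_le r
  obtain ⟨B, c, hdet, hB⟩ := exists_map_of_convex hconv hσ hball hx hx0
  have h1 := h.det_sq_le (h.nonneg h0 h0') one_pos hr hB
  apply Real.le_sqrt_of_sq_le
  rw [le_div_iff₀ (by positivity)]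
  refine le_trans (le_of_eq ?_) h1
  rw [hdet]; ring

theorem exists_normalization_zero (hn : 0 < n) (h : Solution u g H) (h0 : u 0 = 0)
    (h0' : g 0 = 0) {r : ℝ} (hr : 0 < r) : ∃ A : (𝔼 n) →L[ℝ] 𝔼 n, A.det ^ 2 = r ^ n ∧
      ∀ x, u x ≤ r → ∃ y, ‖y‖ ≤ n * (4 * n) ∧ x = A y := by
  have hn' : (0 : ℝ) < n := by exact_mod_cast hn
  have hpos := h.nonneg h0 h0'
  obtain ⟨R, hR⟩ := h.exists_norm_le h0 h0' hr
  obtain ⟨σ, hσ, hball⟩ := h.exists_closedBall_subset h0 hr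
  let e : Fin n → 𝔼 n := fun i => EuclideanSpace.single i 1
  have hen : ∀ i, ‖e i‖ = 1 := fun i => by simp [e]
  have hexp : ∀ y : 𝔼 n, y = ∑ i, y i • e i := fun y => by
    have := (EuclideanSpace.basisFun (Fin n) ℝ).sum_repr y
    simpa using this.symm
  set 𝓑 : Set ((𝔼 n) →L[ℝ] 𝔼 n) := {B | ∀ i, u (B (e i)) ≤ r} with h𝓑
  have hRnn : 0 ≤ R := (norm_nonneg _).trans (hR 0 (by rw [h0]; exact hr.le))
  have hcomp : IsCompact 𝓑 := by
    refine Metric.isCompact_of_isClosed_isBounded ?_ ?_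
    · have : 𝓑 = ⋂ i, {B | u (B (e i)) ≤ r} := by ext; simp [h𝓑]
      rw [this]
      refine isClosed_iInter fun i => isClosed_le ?_ continuous_const
      exact h.continuous.comp (by fun_prop)
    · refine (Metric.isBounded_iff_subset_closedBall 0).2 ⟨n * R, fun B hB => ?_⟩
      rw [mem_closedBall_zero_iff]
      refine ContinuousLinearMap.opNorm_le_bound _ (by positivity) fun y => ?_
      have hBy : B y = ∑ i, y i • B (e i) := by
        conv_lhs => rw [hexp y]
        simp
      rw [hBy]
      calc ‖∑ i, y i • B (e i)‖ ≤ ∑ i, ‖y i • B (e i)‖ := norm_sum_le _ _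
        _ ≤ ∑ _i : Fin n, ‖y‖ * R := Finset.sum_le_sum fun i _ => by
            rw [norm_smul]
            exact mul_le_mul (PiLp.norm_apply_le y i) (hR _ (hB i)) (norm_nonneg _) (norm_nonneg _)
        _ = n * R * ‖y‖ := by simp; ring
  have hmem : σ • ContinuousLinearMap.id ℝ (𝔼 n) ∈ 𝓑 := fun i => hball _ (by
    simp [norm_smul, hen, abs_of_pos hσ])
  obtain ⟨B, hB, hmax⟩ := hcomp.exists_isMaxOn ⟨_, hmem⟩
    (ContinuousLinearMap.continuous_det.abs.continuousOn)
  set D := |B.det| with hD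
  have hDpos : 0 < D := by
    refine lt_of_lt_of_le ?_ (hmax hmem)
    have : (σ • ContinuousLinearMap.id ℝ (𝔼 n)).det = σ ^ n := by
      rw [MongeAmpere.det_smul]; simp [ContinuousLinearMap.det]
    simp only [this]; positivity
  have hBdet : B.det ≠ 0 := abs_pos.1 hDpos
  -- every point of the sublevel set is the image of a point of the unit cube
  have hcoord : ∀ x, u x ≤ r → ∃ c, B c = x ∧ ∀ i, |c i| ≤ 1 := fun x hx => by
    obtain ⟨c, hc⟩ := (LinearMap.equivOfDetNeZero (B : (𝔼 n) →ₗ[ℝ] 𝔼 n) hBdet).surjective x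
    have hc' : B c = x := hc
    refine ⟨c, hc', fun i => ?_⟩
    set B' := B ∘L (ContinuousLinearMap.id ℝ (𝔼 n) + (innerSL ℝ (e i)).smulRight (c - e i))
      with hB'
    have hB'mem : B' ∈ 𝓑 := fun j => by
      rcases eq_or_ne i j with rfl | hij
      · have : B' (e i) = x := by
          simp [hB', hc', hen]
        rw [this]; exact hx
      · have : B' (e j) = B (e j) := by
          have h1 : ⟪e i, e j⟫ = 0 := by
            simp only [e, EuclideanSpace.inner_single_left]; simp [hij]
          simp [hB', h1]
        rw [this]; exact hB j
    have h1 := hmax hB'mem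
    have h2 : B'.det = B.det * c i := by
      rw [hB', det_comp, det_id_add_smulRight, inner_sub_right, real_inner_self_eq_norm_sq, hen]
      congr 1
      simp [e, EuclideanSpace.inner_single_left]
    simp only [mem_ofPred_eq, h2, abs_mul] at h1
    by_contra! hlt
    nlinarith
  -- upper bound for the determinant
  have hDle : D ^ 2 ≤ (12 * n ^ 2 * r) ^ n := by
    obtain ⟨c, hc⟩ := exists_ball_subset_simplex hn
    have := h.det_sq_le hpos (B := B) (c := c) (ρ := 1 / (2 * n)) (by positivity) hr
      fun y hy => by
        obtain ⟨hy1, hy2⟩ := hc y hy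
        have hBy : B y = ∑ i, y i • B (e i) := by
          conv_lhs => rw [hexp y]
          simp
        have h1 : ∀ i, y i * (u (B y) + ⟪g (B y), B (e i) - B y⟫) ≤ y i * r := fun i =>
          mul_le_mul_of_nonneg_left ((h.tangent_le (B y) (B (e i))).trans (hB i)) (hy1 i)
        have h2 := h.tangent_le (B y) 0
        rw [h0] at h2
        have h3 : ∑ i, y i * (u (B y) + ⟪g (B y), B (e i) - B y⟫) =
            (∑ i, y i) * (u (B y) - ⟪g (B y), B y⟫) + ⟪g (B y), B y⟫ := by
          have h5 : ⟪g (B y), B y⟫ = ∑ i, ⟪g (B y), y i • B (e i)⟫ := by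
            rw [← inner_sum, ← hBy]
          conv_rhs => enter [2]; rw [h5]
          rw [Finset.sum_mul, ← Finset.sum_add_distrib]
          refine Finset.sum_congr rfl fun i _ => ?_
          rw [inner_sub_right, inner_smul_right]; ring
        have h4 : ∑ i, y i * (u (B y) + ⟪g (B y), B (e i) - B y⟫) ≤ r := by
          refine (Finset.sum_le_sum fun i _ => h1 i).trans ?_
          rw [← Finset.sum_mul]; nlinarith
        simp only [zero_sub, inner_neg_right] at h2
        rw [h3] at h4
        nlinarith
    rw [hD, sq_abs]
    refine this.trans (le_of_eq ?_)
    congr 1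
    field_simp
    norm_num
  set κ := D ^ (1 / n : ℝ) with hκ
  have hκ0 : 0 < κ := Real.rpow_pos_of_pos hDpos _
  have hκn : κ ^ n = D := by
    rw [hκ, ← Real.rpow_natCast, ← Real.rpow_mul hDpos.le]; simp [hn'.ne']
  have hκle : κ ^ 2 ≤ 12 * n ^ 2 * r := by
    refine le_of_pow_le_pow_left₀ hn.ne' (by positivity) ?_
    rw [← pow_mul, mul_comm 2 n, pow_mul, hκn]; exact hDle
  have hsr := Real.sqrt_pos.2 hr
  have hsr2 := Real.sq_sqrt hr.le
  refine ⟨(Real.sqrt r / κ) • B, ?_, fun x hx => ?_⟩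
  · have h1 : (Real.sqrt r / κ) ^ n * D = Real.sqrt r ^ n := by
      rw [← hκn, ← mul_pow, div_mul_cancel₀ _ hκ0.ne']
    rw [MongeAmpere.det_smul, mul_pow, ← sq_abs B.det, ← hD, ← mul_pow, h1, ← pow_mul, mul_comm,
      pow_mul, hsr2]
  · obtain ⟨c, hc, hc1⟩ := hcoord x hx
    refine ⟨(κ / Real.sqrt r) • c, ?_, ?_⟩
    · have hcn : ‖c‖ ≤ n := by
        have h1 : ‖c‖ ^ 2 ≤ n := by
          rw [EuclideanSpace.norm_sq_eq]
          calc ∑ i, ‖c i‖ ^ 2 ≤ ∑ _i : Fin n, (1 : ℝ) := Finset.sum_le_sum fun i _ => by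
                rw [Real.norm_eq_abs]; exact pow_le_one₀ (abs_nonneg _) (hc1 i)
            _ = n := by simp
        have h2 : (1 : ℝ) ≤ n := by exact_mod_cast hn
        nlinarith [norm_nonneg c]
      have h1 : κ / Real.sqrt r ≤ 4 * n := by
        rw [div_le_iff₀ hsr]
        refine abs_le_of_sq_le_sq' ?_ (by positivity) |>.2
        rw [mul_pow, hsr2, mul_pow]; nlinarith [mul_pos (pow_pos hn' 2) hr]
      rw [norm_smul, Real.norm_of_nonneg (by positivity), mul_comm]
      exact mul_le_mul hcn h1 (by positivity) hn'.le
    · simp only [smul_apply, map_smul, hc, smul_smul]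
      rw [div_mul_div_cancel₀ hsr.ne', div_self hκ0.ne', one_smul]

end Solution

/-- Radius of a ball containing every normalized section. -/
noncomputable def secRadius (n : ℕ) : ℝ := n * (4 * n)

theorem secRadius_pos (hn : 0 < n) : 0 < secRadius n := by
  unfold secRadius; positivity

theorem bijective_of_det_ne_zero {A : (𝔼 n) →L[ℝ] 𝔼 n} (hA : A.det ≠ 0) :
    Function.Bijective A :=
  (LinearMap.equivOfDetNeZero (A : (𝔼 n) →ₗ[ℝ] 𝔼 n) hA).bijective

/-- A solution whose section of height one at the origin is normalized. -/
structure Normalized (u : (𝔼 n) → ℝ) (g : (𝔼 n) → 𝔼 n) (H : (𝔼 n) → (𝔼 n) →L[ℝ] 𝔼 n) : Prop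
    extends Solution u g H where
  zero : u 0 = 0
  grad_zero : g 0 = 0
  norm_le : ∀ x, u x ≤ 1 → ‖x‖ ≤ secRadius n

theorem det_ne_zero_of_sq {A : (𝔼 n) →L[ℝ] 𝔼 n} {r : ℝ} (hr : 0 < r) (hA : A.det ^ 2 = r ^ n) :
    A.det ≠ 0 := fun h => by
  have : 0 < r ^ n := pow_pos hr n
  rw [← hA, h] at this; simp at this

namespace Solution

variable {u : (𝔼 n) → ℝ} {g : (𝔼 n) → 𝔼 n} {H : (𝔼 n) → (𝔼 n) →L[ℝ] 𝔼 n}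

theorem exists_normalized (hn : 0 < n) (h : Solution u g H) (z : 𝔼 n) {r : ℝ} (hr : 0 < r) :
    ∃ A : (𝔼 n) →L[ℝ] 𝔼 n, A.det ^ 2 = r ^ n ∧
      Normalized (MongeAmpere.rescale u g z A r) (rescaleGrad g z A r) (rescaleHess H z A r) := by
  have h1 := h.rescale z (A := ContinuousLinearMap.id ℝ (𝔼 n)) one_pos
    (by simp [ContinuousLinearMap.det])
  obtain ⟨A, hA, hA'⟩ := h1.exists_normalization_zero hn (by simp) (by simp) hr
  refine ⟨A, hA, h.rescale z hr hA, by simp, by simp, fun x hx => ?_⟩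
  have hx' : MongeAmpere.rescale u g z (ContinuousLinearMap.id ℝ (𝔼 n)) 1 (A x) ≤ r := by
    simp only [MongeAmpere.rescale] at hx ⊢
    rw [inv_mul_le_iff₀ hr] at hx
    simpa using hx
  obtain ⟨y, hy, hxy⟩ := hA' _ hx'
  rwa [(bijective_of_det_ne_zero (det_ne_zero_of_sq hr hA)).1 hxy]

theorem isCompact_section (hn : 0 < n) (h : Solution u g H) (z : 𝔼 n) {r : ℝ} (hr : 0 < r) :
    IsCompact {x | gap u g z x ≤ r} := by
  obtain ⟨A, hA, hN⟩ := h.exists_normalized hn z hr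
  have hbij := bijective_of_det_ne_zero (det_ne_zero_of_sq hr hA)
  have hsub : {x | gap u g z x ≤ r} ⊆
      (fun y => z + A y) '' Metric.closedBall 0 (secRadius n) := by
    intro x hx
    obtain ⟨y, hy⟩ := hbij.2 (x - z)
    have hxy : z + A y = x := by rw [hy]; abel
    refine ⟨y, mem_closedBall_zero_iff.2 (hN.norm_le y ?_), hxy⟩
    simp only [MongeAmpere.rescale, hxy]
    rw [inv_mul_le_iff₀ hr]; simpa using hx
  refine ((isCompact_closedBall _ _).image (by fun_prop)).of_isClosed_subset ?_ hsub
  exact isClosed_le (h.continuous_gap z) continuous_const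

end Solution

theorem exists_isLocalMin {q w : (𝔼 n) → ℝ} {ρ : ℝ} {z : 𝔼 n} (hq : Continuous q)
    (hw : Continuous w) (hK : IsCompact {x | q x ≤ ρ}) (hz : q z ≤ ρ)
    (hb : ∀ y, q y = ρ → w z < w y) : ∃ x, q x < ρ ∧ w x ≤ w z ∧ IsLocalMin w x := by
  obtain ⟨x, hx, hmin⟩ := hK.exists_isMinOn ⟨z, hz⟩ hw.continuousOn
  have hxz : w x ≤ w z := hmin hz
  have hxρ : q x < ρ := lt_of_le_of_ne hx fun h => (hb x h).not_ge hxz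
  refine ⟨x, hxρ, hxz, ?_⟩
  filter_upwards [(isOpen_lt hq continuous_const).mem_nhds hxρ] with y hy
  exact hmin (le_of_lt hy : q y ≤ ρ)

theorem ofReal_det_mul_volume_le {B : (𝔼 n) →L[ℝ] 𝔼 n} {c : 𝔼 n} {ρ : ℝ} {P : Set (𝔼 n)}
    (h : ∀ y ∈ Metric.closedBall c ρ, B y ∈ P) :
    ENNReal.ofReal |B.det| * volume (Metric.closedBall c ρ) ≤ volume P := by
  have : B '' Metric.closedBall c ρ ⊆ P := by rintro _ ⟨y, hy, rfl⟩; exact h y hy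
  refine le_trans (le_of_eq ?_) (measure_mono this)
  exact (Measure.addHaar_image_continuousLinearMap volume B _).symm

/-- Lower bound for the distance from points of a normalized section to its complement. -/
noncomputable def secDist (n : ℕ) : ℝ :=
  (1 / (16 * secRadius n)) ^ n / (2 * secRadius n ^ n)

theorem secDist_pos (hn : 0 < n) : 0 < secDist n := by
  have := secRadius_pos hn
  unfold secDist; positivity

namespace Normalized

variable {u : (𝔼 n) → ℝ} {g : (𝔼 n) → 𝔼 n} {H : (𝔼 n) → (𝔼 n) →L[ℝ] 𝔼 n}

theorem lt_one_of_norm_sub_lt (hn : 0 < n) (h : Normalized u g H) {z x : 𝔼 n} (hz : u z ≤ 1 / 2)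
    (hx : ‖x - z‖ < secDist n) : u x < 1 := by
  by_contra! hx1
  have hC := secRadius_pos hn
  have hd := secDist_pos hn
  have hcont : Continuous u := h.continuous
  have hconv : Convex ℝ {y | u y < 1} := by
    simpa using h.convexOn.convex_lt 1
  obtain ⟨φ, hφ⟩ := geometric_hahn_banach_open_point hconv
    (isOpen_lt hcont continuous_const) (x := x) (by simpa using hx1)
  set w := (InnerProductSpace.toDual ℝ (𝔼 n)).symm φ with hw
  have hφw : ∀ y, φ y = ⟪w, y⟫ := fun y => by simp [hw]
  have hzK : u z < 1 := by linarith
  have hw0 : w ≠ 0 := fun h0 => by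
    have := hφ z hzK
    simp [hφw, h0] at this
  have hwn : 0 < ‖w‖ := norm_pos_iff.2 hw0
  set d := secDist n with hdd
  set p : 𝔼 n := (1 / (4 * d * ‖w‖)) • w with hp
  have hpn : ‖p‖ = 1 / (4 * d) := by
    rw [hp, norm_smul, Real.norm_of_nonneg (by positivity)]; field_simp
  set Q : Set (𝔼 n) := {p | ∀ y, u y < 1 → ⟪p, y - z⟫ ≤ 1 / 4} with hQ
  have hQc : Convex ℝ Q := by
    intro a ha b hb s t hs ht hst y hy
    have h1 := mul_le_mul_of_nonneg_left (ha y hy) hs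
    have h2 := mul_le_mul_of_nonneg_left (hb y hy) ht
    rw [inner_add_left, inner_smul_left, inner_smul_left]
    simp only [conj_trivial]
    nlinarith
  set β : ℝ := 1 / (8 * secRadius n) with hβ
  have hβ0 : 0 < β := by positivity
  have hball : Metric.closedBall 0 β ⊆ Q := by
    intro a ha y hy
    rw [mem_closedBall_zero_iff] at ha
    have h1 : ‖y - z‖ ≤ 2 * secRadius n := by
      have h1 := norm_sub_le y z
      have h2 := h.norm_le y hy.le
      have h3 := h.norm_le z hzK.le
      linarith
    calc ⟪a, y - z⟫ ≤ ‖a‖ * ‖y - z‖ := real_inner_le_norm _ _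
      _ ≤ β * (2 * secRadius n) := by gcongr
      _ = 1 / 4 := by rw [hβ]; field_simp; norm_num
  have hpQ : p ∈ Q := by
    intro y hy
    have h1 : ⟪w, y - z⟫ ≤ ‖w‖ * d := by
      have h1 := hφ y hy
      rw [hφw, hφw] at h1
      have h2 : ⟪w, y - z⟫ ≤ ⟪w, x - z⟫ := by rw [inner_sub_right, inner_sub_right]; linarith
      refine h2.trans ((real_inner_le_norm _ _).trans ?_)
      gcongr
    rw [hp, inner_smul_left]
    simp only [conj_trivial]
    calc _ ≤ 1 / (4 * d * ‖w‖) * (‖w‖ * d) := by gcongr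
      _ = 1 / 4 := by field_simp
  obtain ⟨B, c, hB, hBQ⟩ := exists_map_of_convex hQc hβ0 hball hpQ
    (by rw [← norm_pos_iff, hpn]; positivity)
  have hvol1 := ofReal_det_mul_volume_le hBQ
  have hcomp : IsCompact {y | u y ≤ 7 / 8} := by
    have := h.isCompact_section hn 0 (r := 7 / 8) (by norm_num)
    simpa [gap_eq_of_grad_eq_zero h.zero h.grad_zero] using this
  have hvol2 : volume Q ≤ volume (Metric.closedBall (0 : 𝔼 n) (secRadius n)) := by
    refine volume_slopes_le h.toHasHessian (fun x _ => (h.det_eq x).le)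
      Metric.isClosed_closedBall.measurableSet fun p hp => ?_
    obtain ⟨x, hx, -, hmin⟩ := exists_isLocalMin (w := fun y => u y - ⟪p, y⟫) hcont
      (by fun_prop) hcomp (by linarith : u z ≤ 7 / 8) (fun y hy => by
        have := hp y (by linarith)
        rw [inner_sub_right] at this
        linarith)
    exact ⟨x, mem_closedBall_zero_iff.2 (h.norm_le x (by linarith)), hmin⟩
  have hvol := hvol1.trans hvol2
  have : Nonempty (Fin n) := ⟨⟨0, hn⟩⟩
  rw [EuclideanSpace.volume_closedBall, EuclideanSpace.volume_closedBall] at hvol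
  set κ := ENNReal.ofReal (√Real.pi ^ Fintype.card (Fin n) /
    Real.Gamma ((Fintype.card (Fin n) : ℝ) / 2 + 1)) with hκ
  have hκ0 : κ ≠ 0 := by
    rw [hκ, Ne, ENNReal.ofReal_eq_zero, not_le]; positivity
  rw [ENNReal.ofReal_one, one_pow, one_mul, Fintype.card_fin,
    ENNReal.mul_le_mul_iff_left hκ0 ENNReal.ofReal_ne_top, ← ENNReal.ofReal_pow hC.le,
    ENNReal.ofReal_le_ofReal_iff (by positivity)] at hvol
  have hdet : B.det = 2 * secRadius n * secRadius n ^ n := by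
    have hβ2 : β / 2 = 1 / (16 * secRadius n) := by rw [hβ]; field_simp; norm_num
    have hk : 0 < (1 / (16 * secRadius n)) ^ n := by positivity
    rw [hB, hpn, hdd, secDist, hβ2, hβ]
    field_simp
    norm_num
  have hC1 : 1 ≤ secRadius n := by
    have : (1 : ℝ) ≤ n := by exact_mod_cast hn
    unfold secRadius; nlinarith
  rw [hdet, abs_of_pos (by positivity)] at hvol
  have : 0 < secRadius n ^ n := by positivity
  nlinarith

end Normalized

theorem one_le_secRadius (hn : 0 < n) : 1 ≤ secRadius n := by
  have : (1 : ℝ) ≤ n := by exact_mod_cast hn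
  unfold secRadius; nlinarith

/-- Relative amount by which sections may be dilated or reflected. -/
noncomputable def secRatio (n : ℕ) : ℝ := secDist n / (2 * secRadius n)

theorem secRatio_pos (hn : 0 < n) : 0 < secRatio n := by
  have := secRadius_pos hn
  have := secDist_pos hn
  unfold secRatio; positivity

theorem secRatio_lt_one (hn : 0 < n) : secRatio n < 1 := by
  have hC := one_le_secRadius hn
  have hd : secDist n ≤ 1 := by
    unfold secDist
    rw [div_le_one (by positivity)]
    have h1 : (1 / (16 * secRadius n)) ^ n ≤ 1 := by
      apply pow_le_one₀ (by positivity)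
      rw [div_le_one (by positivity)]; linarith
    have h2 : 1 ≤ secRadius n ^ n := one_le_pow₀ hC
    linarith
  unfold secRatio
  rw [div_lt_one (by positivity)]; linarith

theorem secRatio_mul (hn : 0 < n) : secRatio n * secRadius n < secDist n := by
  have hC := secRadius_pos hn
  have hd := secDist_pos hn
  unfold secRatio
  have : secDist n / (2 * secRadius n) * secRadius n = secDist n / 2 := by field_simp
  linarith

namespace Solution

variable {u : (𝔼 n) → ℝ} {g : (𝔼 n) → 𝔼 n} {H : (𝔼 n) → (𝔼 n) →L[ℝ] 𝔼 n}

/-- Points of the half section can be dilated about its centre without leaving the section. -/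
theorem gap_dilate_lt (hn : 0 < n) (h : Solution u g H) {z ξ : 𝔼 n} {ρ : ℝ} (hρ : 0 < ρ)
    (hξ : gap u g z (z + ξ) ≤ ρ / 2) : gap u g z (z + (1 + secRatio n) • ξ) < ρ := by
  obtain ⟨A, hA, hN⟩ := h.exists_normalized hn z hρ
  obtain ⟨y, rfl⟩ := (bijective_of_det_ne_zero (det_ne_zero_of_sq hρ hA)).2 ξ
  have hη := secRatio_pos hn
  have h1 : MongeAmpere.rescale u g z A ρ y ≤ 1 / 2 := by
    rw [MongeAmpere.rescale, inv_mul_le_iff₀ hρ]; linarith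
  have h2 := hN.lt_one_of_norm_sub_lt hn h1 (x := (1 + secRatio n) • y) (by
    rw [add_smul, one_smul, add_sub_cancel_left, norm_smul, Real.norm_of_nonneg hη.le]
    refine lt_of_le_of_lt ?_ (secRatio_mul hn)
    gcongr
    exact hN.norm_le y (by linarith))
  rw [MongeAmpere.rescale, inv_mul_lt_iff₀ hρ, mul_one, map_smul] at h2
  exact h2

/-- Sections are balanced about their centre. -/
theorem gap_reflect_lt (hn : 0 < n) (h : Solution u g H) {z ξ : 𝔼 n} {ρ : ℝ} (hρ : 0 < ρ)
    (hξ : gap u g z (z + ξ) ≤ ρ) : gap u g z (z - secRatio n • ξ) < ρ := by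
  obtain ⟨A, hA, hN⟩ := h.exists_normalized hn z hρ
  obtain ⟨y, rfl⟩ := (bijective_of_det_ne_zero (det_ne_zero_of_sq hρ hA)).2 ξ
  have hη := secRatio_pos hn
  have h1 : MongeAmpere.rescale u g z A ρ y ≤ 1 := by
    rw [MongeAmpere.rescale, inv_mul_le_iff₀ hρ]; linarith
  have h2 := hN.lt_one_of_norm_sub_lt hn (z := 0) (x := -(secRatio n • y))
    (by rw [hN.zero]; norm_num) (by
    rw [sub_zero, norm_neg, norm_smul, Real.norm_of_nonneg hη.le]
    refine lt_of_le_of_lt ?_ (secRatio_mul hn)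
    gcongr
    exact hN.norm_le y h1)
  rw [MongeAmpere.rescale, inv_mul_lt_iff₀ hρ, mul_one, map_neg, map_smul, ← sub_eq_add_neg] at h2
  exact h2

theorem gap_dilate_pow_lt (hn : 0 < n) (h : Solution u g H) {z ξ : 𝔼 n} {ρ : ℝ} (hρ : 0 < ρ)
    (j : ℕ) (hξ : gap u g z (z + ξ) ≤ ρ / 2 ^ j) :
    gap u g z (z + (1 + secRatio n) ^ j • ξ) ≤ ρ := by
  induction j generalizing ρ with
  | zero => simpa using hξ
  | succ j ih =>
    have h1 := ih (ρ := ρ / 2) (by positivity) (by rw [div_div, ← pow_succ']; exact hξ)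
    have := h.gap_dilate_lt hn hρ h1
    rw [smul_smul, ← pow_succ'] at this
    exact this.le

end Solution

/-- Height of the sections engulfed by a normalized section. -/
noncomputable def secHeight (n : ℕ) : ℝ := secRatio n / 4

theorem secHeight_pos (hn : 0 < n) : 0 < secHeight n := by
  have := secRatio_pos hn
  unfold secHeight; positivity

namespace Normalized

variable {u : (𝔼 n) → ℝ} {g : (𝔼 n) → 𝔼 n} {H : (𝔼 n) → (𝔼 n) →L[ℝ] 𝔼 n}

theorem nonneg (h : Normalized u g H) (x : 𝔼 n) : 0 ≤ u x :=
  h.toSolution.nonneg h.zero h.grad_zero x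

theorem lt_one_of_gap_le (hn : 0 < n) (h : Normalized u g H) {z x : 𝔼 n} (hz : u z ≤ secHeight n)
    (hx : gap u g z x ≤ secHeight n) : u x < 1 := by
  have hη := secRatio_pos hn
  have hη1 := secRatio_lt_one hn
  have hh := secHeight_pos hn
  have h1 := h.gap_reflect_lt hn hh (z := z) (ξ := x - z) (by simpa using hx)
  have h2 := h.nonneg (z - secRatio n • (x - z))
  simp only [gap, sub_sub_cancel_left, inner_neg_right, inner_smul_right] at h1 hx
  have h3 : secRatio n * ⟪g z, x - z⟫ ≤ secRatio n * (1 / 2) := by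
    unfold secHeight at *; linarith
  have h4 := le_of_mul_le_mul_left h3 hη
  unfold secHeight at *; linarith

theorem norm_sub_le_of_gap_le (hn : 0 < n) (h : Normalized u g H) {z x : 𝔼 n}
    (hz : u z ≤ secHeight n) (j : ℕ) (hx : gap u g z x ≤ secHeight n / 2 ^ j) :
    ‖x - z‖ ≤ 2 * secRadius n / (1 + secRatio n) ^ j := by
  have hη := secRatio_pos hn
  have h1 := h.gap_dilate_pow_lt hn (secHeight_pos hn) j (z := z) (ξ := x - z)
    (by simpa using hx)
  have h2 := h.norm_le _ (h.lt_one_of_gap_le hn hz h1).le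
  have h3 := h.norm_le z (by have := secRatio_lt_one hn; unfold secHeight at hz; linarith)
  rw [le_div_iff₀ (by positivity)]
  calc ‖x - z‖ * (1 + secRatio n) ^ j = ‖(1 + secRatio n) ^ j • (x - z)‖ := by
        rw [norm_smul, Real.norm_of_nonneg (by positivity), mul_comm]
    _ = ‖z + (1 + secRatio n) ^ j • (x - z) - z‖ := by rw [add_sub_cancel_left]
    _ ≤ _ := (norm_sub_le _ _).trans (by linarith)

end Normalized

/-- Measure estimate in a section: a nonnegative supersolution that is at most `t` at the centre
is at most `3 * t / 2` on a set of definite measure. -/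
theorem Solution.volume_section_ge {u v : (𝔼 n) → ℝ} {g gv : (𝔼 n) → 𝔼 n}
    {H Hv : (𝔼 n) → (𝔼 n) →L[ℝ] 𝔼 n} (hn : 0 < n) (h : Solution u g H)
    (hv : HasHessian v gv Hv) (hvs : IsSuper H Hv) {z : 𝔼 n} {ρ t : ℝ} (hρ : 0 < ρ) (ht : 0 < t)
    (hv0 : ∀ x, gap u g z x ≤ ρ → 0 ≤ v x) (hvz : v z ≤ t) :
    ENNReal.ofReal √(ρ ^ n) * volume (Metric.closedBall (0 : 𝔼 n) (1 / (4 * secRadius n))) ≤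
      volume {x | gap u g z x ≤ ρ ∧ v x ≤ 3 / 2 * t} := by
  obtain ⟨A, hA, hN⟩ := h.exists_normalized hn z hρ
  have hC := secRadius_pos hn
  have hA0 := det_ne_zero_of_sq hρ hA
  have hAd : (ContinuousLinearMap.adjoint A).det ≠ 0 := by rwa [det_adjoint]
  set e := LinearMap.equivOfDetNeZero
    ((ContinuousLinearMap.adjoint A : (𝔼 n) →L[ℝ] 𝔼 n) : (𝔼 n) →ₗ[ℝ] 𝔼 n) hAd with he
  have hecoe : ∀ x, e x = ContinuousLinearMap.adjoint A x := fun x => rfl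
  set B : (𝔼 n) →L[ℝ] 𝔼 n := ρ • LinearMap.toContinuousLinearMap (e.symm : (𝔼 n) →ₗ[ℝ] 𝔼 n)
    with hB
  have hAB : ∀ p, ContinuousLinearMap.adjoint A (B p) = ρ • p := fun p => by
    rw [hB, smul_apply, map_smul, ← hecoe]
    simp
  clear_value B
  have hBdet : A.det * B.det = ρ ^ n := by
    have h1 : (ContinuousLinearMap.adjoint A) ∘L B = ρ • ContinuousLinearMap.id ℝ (𝔼 n) := by
      ext1 p; simpa using hAB p
    have h2 := congrArg ContinuousLinearMap.det h1
    rw [det_comp, det_adjoint, det_smul] at h2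
    simpa [ContinuousLinearMap.det] using h2
  have hBabs : |B.det| = √(ρ ^ n) := by
    rw [← Real.sqrt_sq_eq_abs]
    congr 1
    have h1 : (A.det * B.det) ^ 2 = ρ ^ n * ρ ^ n := by rw [hBdet, sq]
    rw [mul_pow, hA] at h1
    exact mul_left_cancel₀ (pow_pos hρ n).ne' h1
  set Q : Set (𝔼 n) := {p | ∀ x, gap u g z x ≤ ρ → ⟪p, x - z⟫ ≤ ρ / 4} with hQ
  have hBQ : ∀ p ∈ Metric.closedBall (0 : 𝔼 n) (1 / (4 * secRadius n)), B p ∈ Q := by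
    intro p hp x hx
    rw [mem_closedBall_zero_iff] at hp
    obtain ⟨y, hy⟩ := (bijective_of_det_ne_zero hA0).2 (x - z)
    have hy1 : ‖y‖ ≤ secRadius n := by
      refine hN.norm_le y ?_
      rw [MongeAmpere.rescale, hy, inv_mul_le_iff₀ hρ]
      simpa using hx
    rw [← hy, ← ContinuousLinearMap.adjoint_inner_left, hAB, inner_smul_left]
    simp only [conj_trivial]
    calc ρ * ⟪p, y⟫ ≤ ρ * (‖p‖ * ‖y‖) := by gcongr; exact real_inner_le_norm _ _
      _ ≤ ρ * (1 / (4 * secRadius n) * secRadius n) := by gcongr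
      _ = ρ / 4 := by field_simp
  have hvol1 := ofReal_det_mul_volume_le hBQ
  rw [hBabs] at hvol1
  refine hvol1.trans ?_
  set s := ρ / (2 * t) with hs
  have hs0 : 0 < s := by positivity
  have hw := (h.hasHessian_gap z).add (hv.const_smul s)
  have hcq := h.continuous_gap z
  have hcv := hv.continuous
  refine volume_slopes_le hw (fun x hx => hvs.det_add_le h hs0.le x hx) ?_ fun p hp => ?_
  · exact ((isClosed_le hcq continuous_const).inter
      (isClosed_le hcv continuous_const)).measurableSet
  have hst : s * t = ρ / 2 := by rw [hs]; field_simp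
  have hsv : s * v z ≤ ρ / 2 := hst ▸ mul_le_mul_of_nonneg_left hvz hs0.le
  obtain ⟨x, hx, hxw, hmin⟩ := exists_isLocalMin (q := gap u g z) (ρ := ρ) (z := z)
    (w := fun y => gap u g z y + s * v y - ⟪p, y⟫) hcq
    (by fun_prop) (h.isCompact_section hn z hρ) (by rw [gap_self]; exact hρ.le) (fun y hy => by
      have h1 := hp y hy.le
      have h2 := mul_nonneg hs0.le (hv0 y hy.le)
      rw [inner_sub_right] at h1
      simp only [gap_self, hy]
      linarith)
  refine ⟨x, ⟨hx.le, ?_⟩, hmin⟩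
  have h1 := hp x hx.le
  have h2 := h.gap_nonneg z x
  simp only [gap_self] at hxw
  rw [inner_sub_right] at h1
  have h3 : s * v x ≤ s * (3 / 2 * t) := by linarith
  exact le_of_mul_le_mul_left h3 hs0

/-- The cutoff `max (R ^ 2 - ‖y‖ ^ 2) 0 ^ 2`. -/
noncomputable def cutoff (R : ℝ) (y : 𝔼 n) : ℝ := max (R ^ 2 - ‖y‖ ^ 2) 0 ^ 2

theorem continuous_cutoff (R : ℝ) : Continuous (cutoff R : (𝔼 n) → ℝ) := by
  unfold cutoff; fun_prop

theorem cutoff_eq_zero {R : ℝ} (hR : 0 ≤ R) {y : 𝔼 n} (hy : R ≤ ‖y‖) : cutoff R y = 0 := by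
  have : R ^ 2 - ‖y‖ ^ 2 ≤ 0 := by nlinarith
  simp [cutoff, max_eq_right this]

theorem hasCompactSupport_cutoff {R : ℝ} (hR : 0 ≤ R) :
    HasCompactSupport (cutoff R : (𝔼 n) → ℝ) :=
  HasCompactSupport.intro (isCompact_closedBall 0 R) fun y hy => cutoff_eq_zero hR (by
    rw [mem_closedBall_zero_iff, not_le] at hy; exact hy.le)

theorem diff2_cutoff_le {R : ℝ} (a y : 𝔼 n) :
    diff2 (cutoff R) a y ≤ 8 * ⟪y, a⟫ ^ 2 := by
  have key : ∀ p c : ℝ, max (p - c) 0 ^ 2 + max (p + c) 0 ^ 2 - 2 * max p 0 ^ 2 ≤ 2 * c ^ 2 := by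
    intro p c
    rcases le_total 0 p with hp | hp
    · rw [max_eq_left hp]
      rcases le_total 0 (p - c) with h1 | h1 <;> rcases le_total 0 (p + c) with h2 | h2 <;>
        simp only [h1, h2, max_eq_left, max_eq_right] <;> nlinarith
    · rw [max_eq_right hp]
      rcases le_total 0 (p - c) with h1 | h1 <;> rcases le_total 0 (p + c) with h2 | h2 <;>
        simp only [h1, h2, max_eq_left, max_eq_right] <;> nlinarith
  have h1 : max (R ^ 2 - ‖y + a‖ ^ 2) 0 ^ 2 ≤ max ((R ^ 2 - ‖y‖ ^ 2) - 2 * ⟪y, a⟫) 0 ^ 2 := by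
    refine pow_le_pow_left₀ (le_max_right _ _) (max_le_max_right 0 ?_) 2
    rw [norm_add_sq_real]; nlinarith [sq_nonneg ‖a‖]
  have h2 : max (R ^ 2 - ‖y - a‖ ^ 2) 0 ^ 2 ≤ max ((R ^ 2 - ‖y‖ ^ 2) + 2 * ⟪y, a⟫) 0 ^ 2 := by
    refine pow_le_pow_left₀ (le_max_right _ _) (max_le_max_right 0 ?_) 2
    rw [norm_sub_sq_real]; nlinarith [sq_nonneg ‖a‖]
  have := key (R ^ 2 - ‖y‖ ^ 2) (2 * ⟪y, a⟫)
  simp only [diff2, cutoff]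
  linarith

theorem integral_mul_diff2 {u φ : (𝔼 n) → ℝ} (hu : Continuous u) (hφ : Continuous φ)
    (hφs : HasCompactSupport φ) (a : 𝔼 n) : Integrable (fun y => diff2 φ a y * u y) ∧
    ∫ y, φ y * diff2 u a y = ∫ y, diff2 φ a y * u y := by
  have hint : ∀ b : 𝔼 n, Integrable (fun y => φ y * u (y + b)) := fun b =>
    (by fun_prop : Continuous fun y => φ y * u (y + b)).integrable_of_hasCompactSupport
      hφs.mul_right
  have htr : ∀ b : 𝔼 n, ∫ y, φ y * u (y + b) = ∫ y, φ (y - b) * u y := fun b => by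
    simpa using integral_add_right_eq_self (μ := volume) (fun y => φ (y - b) * u y) b
  have hint' : ∀ b : 𝔼 n, Integrable (fun y => φ (y - b) * u y) := fun b => by
    simpa using (hint b).comp_sub_right b
  have e1 : (fun y => φ y * diff2 u a y) =
      fun y => φ y * u (y + a) + φ y * u (y + -a) - 2 * (φ y * u (y + 0)) := by
    ext y; simp only [diff2, add_zero, ← sub_eq_add_neg]; ring
  have e2 : (fun y => diff2 φ a y * u y) =
      fun y => φ (y - a) * u y + φ (y - -a) * u y - 2 * (φ (y - 0) * u y) := by
    ext y; simp only [diff2, sub_zero, sub_neg_eq_add]; ring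
  have i1 : Integrable fun y => φ y * u (y + a) + φ y * u (y + -a) := (hint _).add (hint _)
  have i2 : Integrable fun y => φ (y - a) * u y + φ (y - -a) * u y := (hint' _).add (hint' _)
  rw [e1, e2]
  refine ⟨i2.sub ((hint' _).const_mul _), ?_⟩
  rw [integral_sub i1 ((hint _).const_mul _), integral_sub i2 ((hint' _).const_mul _),
    integral_add (hint _) (hint _), integral_add (hint' _) (hint' _), integral_const_mul,
    integral_const_mul, htr, htr, htr]

theorem Solution.volume_diff2_ge_le {u : (𝔼 n) → ℝ} {g : (𝔼 n) → 𝔼 n}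
    {H : (𝔼 n) → (𝔼 n) →L[ℝ] 𝔼 n} (h : Solution u g H) {R t m : ℝ}
    (ht : 0 < t) (htR : t ≤ R) (hu0 : ∀ x, 0 ≤ u x)
    (hu1 : ∀ x, ‖x‖ ≤ 3 * R → u x ≤ 1) {e : 𝔼 n} (he : ‖e‖ = 1) (hm : 0 ≤ m) :
    m * volume.real {y | ‖y‖ ≤ R ∧ m * t ^ 2 ≤ diff2 u (t • e) y} ≤
      8 / R ^ 2 * volume.real (Metric.closedBall (0 : 𝔼 n) (3 * R)) := by
  have hR : 0 < R := ht.trans_le htR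
  have hta : ‖t • e‖ = t := by rw [norm_smul, he, Real.norm_of_nonneg ht.le, mul_one]
  set a := t • e with ha
  have hc := continuous_cutoff (n := n) (2 * R)
  have hs := hasCompactSupport_cutoff (n := n) (R := 2 * R) (by positivity)
  have hcu := h.continuous
  have hcd := h.continuous_diff2 a
  have hf0 : ∀ y, 0 ≤ cutoff (2 * R) y * diff2 u a y := fun y =>
    mul_nonneg (sq_nonneg _) (h.diff2_nonneg a y)
  have hfi : Integrable (fun y => cutoff (2 * R) y * diff2 u a y) :=
    (hc.mul hcd).integrable_of_hasCompactSupport hs.mul_right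
  have hupper : ∫ y, cutoff (2 * R) y * diff2 u a y ≤
      72 * R ^ 2 * t ^ 2 * volume.real (Metric.closedBall (0 : 𝔼 n) (3 * R)) := by
    obtain ⟨hint, heq⟩ := integral_mul_diff2 hcu hc hs a
    rw [heq]
    calc ∫ y, diff2 (cutoff (2 * R)) a y * u y
        ≤ ∫ y, (Metric.closedBall (0 : 𝔼 n) (3 * R)).indicator
            (fun _ => 72 * R ^ 2 * t ^ 2) y := by
          refine integral_mono hint (IntegrableOn.integrable_indicator ?_
            Metric.isClosed_closedBall.measurableSet) fun y => ?_
          · exact integrableOn_const (isCompact_closedBall _ _).measure_lt_top.ne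
          by_cases hy : ‖y‖ ≤ 3 * R
          · rw [indicator_of_mem (mem_closedBall_zero_iff.2 hy)]
            have h1 := diff2_cutoff_le (R := 2 * R) a y
            have h2 : ⟪y, a⟫ ^ 2 ≤ (3 * R * t) ^ 2 := by
              rw [sq_le_sq, abs_of_nonneg (by positivity : 0 ≤ 3 * R * t)]
              refine (abs_real_inner_le_norm _ _).trans ?_
              rw [hta]; gcongr
            have h3 : diff2 (cutoff (2 * R)) a y ≤ 72 * R ^ 2 * t ^ 2 := by nlinarith
            calc _ ≤ 72 * R ^ 2 * t ^ 2 * u y := mul_le_mul_of_nonneg_right h3 (hu0 y)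
              _ ≤ 72 * R ^ 2 * t ^ 2 * 1 := by gcongr; exact hu1 y hy
              _ = _ := mul_one _
          · rw [indicator_of_notMem (by rwa [mem_closedBall_zero_iff])]
            push Not at hy
            have h1 := norm_sub_norm_le y (-a)
            have h2 := norm_sub_norm_le y a
            rw [sub_neg_eq_add, norm_neg] at h1
            have hR2 : 0 ≤ 2 * R := by positivity
            simp only [diff2]
            rw [cutoff_eq_zero hR2 (by linarith), cutoff_eq_zero hR2 (by linarith),
              cutoff_eq_zero hR2 (by linarith)]
            simp
      _ = _ := by
          rw [integral_indicator_const _ Metric.isClosed_closedBall.measurableSet, smul_eq_mul,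
            mul_comm]
  have hlow := mul_meas_ge_le_integral_of_nonneg (Eventually.of_forall hf0) hfi
    (9 * R ^ 4 * (m * t ^ 2))
  have hsub : {y | ‖y‖ ≤ R ∧ m * t ^ 2 ≤ diff2 u a y} ⊆
      {y | 9 * R ^ 4 * (m * t ^ 2) ≤ cutoff (2 * R) y * diff2 u a y} := by
    rintro y ⟨hy, hy'⟩
    have h1 : 9 * R ^ 4 ≤ cutoff (2 * R) y := by
      have : 3 * R ^ 2 ≤ max ((2 * R) ^ 2 - ‖y‖ ^ 2) 0 := by
        refine le_trans ?_ (le_max_left _ _)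
        nlinarith [norm_nonneg y]
      calc 9 * R ^ 4 = (3 * R ^ 2) ^ 2 := by ring
        _ ≤ _ := by unfold cutoff; gcongr
    exact mul_le_mul h1 hy' (by positivity) (sq_nonneg _)
  rcases hm.eq_or_lt with rfl | hm
  · rw [zero_mul]; positivity
  have hfin := hfi.measure_ge_lt_top (ε := 9 * R ^ 4 * (m * t ^ 2)) (by positivity)
  have hmono := measureReal_mono hsub hfin.ne
  have h1 : 9 * R ^ 4 * t ^ 2 * (m * volume.real {y | ‖y‖ ≤ R ∧ m * t ^ 2 ≤ diff2 u a y}) ≤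
      9 * R ^ 4 * t ^ 2 *
        (8 / R ^ 2 * volume.real (Metric.closedBall (0 : 𝔼 n) (3 * R))) := by
    calc _ = 9 * R ^ 4 * (m * t ^ 2) *
          volume.real {y | ‖y‖ ≤ R ∧ m * t ^ 2 ≤ diff2 u a y} := by ring
      _ ≤ _ := (mul_le_mul_of_nonneg_left hmono (by positivity)).trans (hlow.trans hupper)
      _ = _ := by field_simp; ring
  exact le_of_mul_le_mul_left h1 (by positivity)

theorem HasHessian.exists_diff2_eq {u : (𝔼 n) → ℝ} {g : (𝔼 n) → 𝔼 n}
    {H : (𝔼 n) → (𝔼 n) →L[ℝ] 𝔼 n} (h : HasHessian u g H) (e y : 𝔼 n) {t : ℝ} (ht : 0 < t) :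
    ∃ ζ ∈ Ioo 0 t, diff2 u (t • e) y =
      t ^ 2 * ((⟪H (y + ζ • e) e, e⟫ + ⟪H (y - ζ • e) e, e⟫) / 2) := by
  have d1 : ∀ s : ℝ, HasDerivAt (fun s : ℝ => diff2 u (s • e) y)
      (⟪g (y + s • e), e⟫ - ⟪g (y - s • e), e⟫) s := fun s => by
    have h1 := h.hasDerivAt_line y e s
    have h2 := h.hasDerivAt_line y (-e) s
    simp only [smul_neg, ← sub_eq_add_neg, inner_neg_right] at h2
    have h3 := (h1.add h2).sub_const (2 * u y)
    rw [sub_eq_add_neg]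
    exact h3
  have d2 : ∀ s : ℝ, HasDerivAt (fun s : ℝ => ⟪g (y + s • e), e⟫ - ⟪g (y - s • e), e⟫)
      (⟪H (y + s • e) e, e⟫ + ⟪H (y - s • e) e, e⟫) s := fun s => by
    have h1 := h.hasDerivAt_line_grad y e e s
    have h2 := h.hasDerivAt_line_grad y (-e) e s
    simp only [smul_neg, ← sub_eq_add_neg, map_neg, inner_neg_left] at h2
    have h3 := h1.sub h2
    rw [sub_neg_eq_add] at h3
    exact h3
  have dsq : ∀ s : ℝ, HasDerivAt (fun s : ℝ => s ^ 2) (2 * s) s := fun s => by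
    simpa using hasDerivAt_pow 2 s
  obtain ⟨s, hs, h1⟩ := exists_ratio_hasDerivAt_eq_ratio_slope _ _ ht
    (fun x _ => (d1 x).continuousAt.continuousWithinAt) (fun x _ => d1 x) _ _
    (fun x _ => (dsq x).continuousAt.continuousWithinAt) (fun x _ => dsq x)
  obtain ⟨ζ, hζ, h2⟩ := exists_hasDerivAt_eq_slope _ _ hs.1
    (fun x _ => (d2 x).continuousAt.continuousWithinAt) (fun x _ => d2 x)
  refine ⟨ζ, ⟨hζ.1, hζ.2.trans hs.2⟩, ?_⟩
  have hs0 := hs.1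
  simp only [zero_smul, add_zero, sub_zero, sub_self, diff2] at h1 h2 ⊢
  rw [h2]
  field_simp
  linarith

theorem HasHessian.inner_hess_le_of_diff2_le {u : (𝔼 n) → ℝ} {g : (𝔼 n) → 𝔼 n}
    {H : (𝔼 n) → (𝔼 n) →L[ℝ] 𝔼 n} (h : HasHessian u g H) (e : 𝔼 n) {K : ℝ} {y : 𝔼 n}
    {τ : ℝ} (hτ : 0 < τ) (hK : ∀ t, 0 < t → t ≤ τ → diff2 u (t • e) y ≤ K * t ^ 2) :
    ⟪H y e, e⟫ ≤ K := by
  by_contra! hlt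
  have hc : Continuous fun s : ℝ => (⟪H (y + s • e) e, e⟫ + ⟪H (y - s • e) e, e⟫) / 2 := by
    have := h.cont
    fun_prop
  have h0 : ∀ᶠ s in 𝓝 (0 : ℝ), K < (⟪H (y + s • e) e, e⟫ + ⟪H (y - s • e) e, e⟫) / 2 := by
    apply hc.continuousAt.eventually_const_lt
    simpa using hlt
  obtain ⟨ε, hε, hball⟩ := Metric.eventually_nhds_iff.1 h0
  obtain ⟨ζ, hζ, heq⟩ := h.exists_diff2_eq e y (t := min ε τ) (by positivity)
  have h1 := hK (min ε τ) (by positivity) (min_le_right _ _)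
  have h2 := @hball ζ (by
    rw [Real.dist_eq, sub_zero, abs_of_pos hζ.1]
    exact hζ.2.trans_le (min_le_left _ _))
  rw [heq, mul_comm K] at h1
  have h3 : 0 < (min ε τ) ^ 2 := by positivity
  have := le_of_mul_le_mul_left h1 h3
  linarith

/-- Radius of the ball on which the interior second derivative estimate is proved. -/
noncomputable def estRadius (n : ℕ) : ℝ := secHeight n * secDist n / 2

theorem estRadius_pos (hn : 0 < n) : 0 < estRadius n := by
  have := secHeight_pos hn
  have := secDist_pos hn
  unfold estRadius; positivity

theorem secHeight_lt (hn : 0 < n) : secHeight n < 1 / 4 := by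
  have := secRatio_lt_one hn
  unfold secHeight; linarith

namespace Normalized

variable {u : (𝔼 n) → ℝ} {g : (𝔼 n) → 𝔼 n} {H : (𝔼 n) → (𝔼 n) →L[ℝ] 𝔼 n}

theorem lt_one_of_norm_lt (hn : 0 < n) (h : Normalized u g H) {x : 𝔼 n}
    (hx : ‖x‖ < secDist n) : u x < 1 :=
  h.lt_one_of_norm_sub_lt hn (z := 0) (by rw [h.zero]; norm_num) (by simpa using hx)

theorem le_one_of_norm_le (hn : 0 < n) (h : Normalized u g H) {x : 𝔼 n}
    (hx : ‖x‖ ≤ 3 * estRadius n) : u x ≤ 1 := by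
  refine (h.lt_one_of_norm_lt hn (hx.trans_lt ?_)).le
  have := secHeight_lt hn
  have := secDist_pos hn
  unfold estRadius; nlinarith

theorem le_secHeight_of_norm_le (hn : 0 < n) (h : Normalized u g H) {x : 𝔼 n}
    (hx : ‖x‖ ≤ estRadius n) : u x ≤ secHeight n := by
  have hh := secHeight_pos hn
  have hh1 := secHeight_lt hn
  have hd := secDist_pos hn
  have h1 : u ((secHeight n)⁻¹ • x) < 1 := by
    refine h.lt_one_of_norm_lt hn ?_
    rw [norm_smul, norm_inv, Real.norm_of_nonneg hh.le, inv_mul_lt_iff₀ hh]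
    unfold estRadius at hx; nlinarith
  have h2 := h.convexOn.2 (mem_univ ((secHeight n)⁻¹ • x)) (mem_univ 0) hh.le
    (by linarith : 0 ≤ 1 - secHeight n) (by ring)
  rw [smul_smul, mul_inv_cancel₀ hh.ne', one_smul, smul_zero, add_zero, h.zero, smul_zero,
    add_zero, smul_eq_mul] at h2
  nlinarith

end Normalized

set_option maxHeartbeats 1000000 in
theorem exists_diff2_le (hn : 0 < n) : ∃ K : ℝ, 0 < K ∧
    ∀ (u : (𝔼 n) → ℝ) (g : (𝔼 n) → 𝔼 n) (H : (𝔼 n) → (𝔼 n) →L[ℝ] 𝔼 n), Normalized u g H →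
    ∀ e : 𝔼 n, ‖e‖ = 1 → ∀ t, 0 < t → t ≤ estRadius n → ∀ y, ‖y‖ ≤ estRadius n / 2 →
      diff2 u (t • e) y ≤ K * t ^ 2 := by
  have hη := secRatio_pos hn
  have hC := secRadius_pos hn
  have hh := secHeight_pos hn
  have hh1 := secHeight_lt hn
  have hR := estRadius_pos hn
  set η := secRatio n
  set C := secRadius n
  set h₀ := secHeight n
  set R := estRadius n
  obtain ⟨N, hN⟩ : ∃ N : ℕ, 2 ^ n ≤ (1 + η) ^ N := by
    obtain ⟨N, hN⟩ := pow_unbounded_of_one_lt (2 ^ n) (by linarith : 1 < 1 + η)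
    exact ⟨N, hN.le⟩
  have hN0 : 0 < (N : ℝ) := by
    rcases N.eq_zero_or_pos with rfl | h
    · have := one_lt_pow₀ (one_lt_two : (1 : ℝ) < 2) hn.ne'
      rw [pow_zero] at hN; linarith
    · exact_mod_cast h
  have hN1 : (1 : ℝ) ≤ N := by exact_mod_cast hN0
  set δ : ℝ := 1 / (2 * N) with hδ
  have hδ0 : 0 < δ := by positivity
  have hδ1 : δ ≤ 1 / 2 := by
    rw [hδ]; gcongr; linarith
  set L : ℝ := (1 + η) * (R + 2 * C / δ) with hL
  set κ := volume.real (Metric.closedBall (0 : 𝔼 n) (1 / (4 * C))) with hκ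
  have hκ0 : 0 < κ := by
    refine ENNReal.toReal_pos (Metric.measure_closedBall_pos _ _ (by positivity)).ne'
      (isCompact_closedBall _ _).measure_lt_top.ne
  set V := volume.real (Metric.closedBall (0 : 𝔼 n) (3 * R)) with hV
  set K₀ : ℝ := L ^ N * (16 * V / (R ^ 2 * κ * h₀ ^ n)) with hK₀
  have hL0 : 0 < L := by positivity
  have hV0 : 0 ≤ V := measureReal_nonneg
  have hK0' : 0 ≤ K₀ := by positivity
  refine ⟨K₀ / (R / 2) ^ N + 1, by positivity, fun u g H h e he t ht htR y hy => ?_⟩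
  set W : (𝔼 n) → ℝ := fun y => (t ^ 2)⁻¹ * diff2 u (t • e) y with hW
  have hW0 : ∀ y, 0 ≤ W y := fun y => mul_nonneg (by positivity) (h.diff2_nonneg _ _)
  have hWc : Continuous W := continuous_const.mul (h.continuous_diff2 _)
  suffices hWy : W y ≤ K₀ / (R / 2) ^ N by
    simp only [hW] at hWy
    rw [inv_mul_le_iff₀ (by positivity)] at hWy
    nlinarith [sq_nonneg t]
  obtain ⟨z, hz, hmax⟩ := (isCompact_closedBall (0 : 𝔼 n) R).exists_isMaxOn
    ⟨0, by simp [hR.le]⟩ (f := fun z => (R - ‖z‖) ^ N * W z) (by fun_prop)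
  rw [mem_closedBall_zero_iff] at hz
  have hle : ∀ x : 𝔼 n, ‖x‖ ≤ R → (R - ‖x‖) ^ N * W x ≤ (R - ‖z‖) ^ N * W z := fun x hx =>
    hmax (mem_closedBall_zero_iff.2 hx)
  suffices hz0 : (R - ‖z‖) ^ N * W z ≤ K₀ by
    rw [le_div_iff₀ (by positivity), mul_comm]
    calc (R / 2) ^ N * W y ≤ (R - ‖y‖) ^ N * W y := by
          gcongr
          · exact hW0 y
          · linarith
      _ ≤ _ := (hle y (by linarith)).trans hz0
  set s := R - ‖z‖ with hs
  set M := W z with hM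
  rcases (hW0 z).eq_or_lt with hM0 | hM0
  · rw [hM, ← hM0, mul_zero]; exact hK0'
  rcases (sub_nonneg.2 hz).eq_or_lt with hs0 | hs0
  · rw [hs, ← hs0, zero_pow (by exact_mod_cast hN0.ne'), zero_mul]; exact hK0'
  rw [← hs] at hs0
  rw [← hM] at hM0
  obtain ⟨j, hj1, hj2⟩ := exists_nat_pow_near (x := max 1 (2 * C / (δ * s))) (le_max_left _ _)
    (by linarith : 1 < 1 + η)
  have hsj : s * (1 + η) ^ (j + 1) ≤ L := by
    have h1 : s * max 1 (2 * C / (δ * s)) ≤ R + 2 * C / δ := by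
      rw [mul_max_of_nonneg _ _ hs0.le]
      have : s * (2 * C / (δ * s)) = 2 * C / δ := by field_simp
      rw [this, mul_one]
      apply max_le
      · have : 0 ≤ 2 * C / δ := by positivity
        linarith [norm_nonneg z]
      · linarith
    rw [pow_succ, hL]
    nlinarith [mul_le_mul_of_nonneg_left hj1 hs0.le]
  have hjs : 2 * C / (1 + η) ^ (j + 1) ≤ δ * s := by
    have h1 := (le_max_right _ _).trans hj2.le
    rw [div_le_iff₀ (by positivity)] at h1 ⊢
    linarith
  have hzh := h.le_secHeight_of_norm_le hn hz
  have hWball : ∀ x, ‖x - z‖ ≤ δ * s → ‖x‖ ≤ R ∧ W x ≤ 2 * M := by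
    intro x hx
    have hxn : ‖x‖ ≤ ‖z‖ + δ * s := by
      have := norm_add_le (x - z) z
      rw [sub_add_cancel] at this; linarith
    have hxR : ‖x‖ ≤ R := by nlinarith
    refine ⟨hxR, ?_⟩
    have h1 : ((1 - δ) * s) ^ N * W x ≤ s ^ N * M := by
      refine le_trans ?_ (hle x hxR)
      gcongr
      · exact hW0 x
      · nlinarith
      · linarith
    have hbern : 1 / 2 ≤ (1 - δ) ^ N := by
      have := one_add_mul_le_pow (a := -δ) (by linarith) N
      have h2 : (N : ℝ) * δ = 1 / 2 := by rw [hδ]; field_simp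
      rw [← sub_eq_add_neg] at this
      linarith
    rw [mul_pow, mul_comm _ (s ^ N), mul_assoc] at h1
    have h3 := le_of_mul_le_mul_left h1 (by positivity)
    have h4 := mul_le_mul_of_nonneg_right hbern (hW0 x)
    linarith
  set ρ := h₀ / 2 ^ (j + 1) with hρ
  have hρ0 : 0 < ρ := by positivity
  obtain ⟨gv, Hv, hv, hvs⟩ := h.exists_isSuper_sub_diff2 (2 * M) (c := (t ^ 2)⁻¹)
    (by positivity) (t • e)
  have hsec : ∀ x, gap u g z x ≤ ρ → ‖x - z‖ ≤ δ * s := fun x hx =>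
    (h.norm_sub_le_of_gap_le hn hzh (j + 1) hx).trans hjs
  have hvol := h.volume_section_ge hn hv hvs hρ0 hM0 (z := z)
    (fun x hx => by have := (hWball x (hsec x hx)).2; simp only [hW] at this; linarith)
    (by simp only [hM, hW]; linarith)
  have hmeas := h.volume_diff2_ge_le ht htR h.nonneg (fun x hx => h.le_one_of_norm_le hn hx) he
    (m := M / 2) (by positivity)
  have hsub : {x | gap u g z x ≤ ρ ∧ 2 * M - (t ^ 2)⁻¹ * diff2 u (t • e) x ≤ 3 / 2 * M} ⊆
      {y | ‖y‖ ≤ R ∧ M / 2 * t ^ 2 ≤ diff2 u (t • e) y} := by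
    rintro x ⟨hx1, hx2⟩
    refine ⟨(hWball x (hsec x hx1)).1, ?_⟩
    have : M / 2 ≤ (t ^ 2)⁻¹ * diff2 u (t • e) x := by linarith
    rwa [le_inv_mul_iff₀ (by positivity), mul_comm] at this
  have hfin : volume {y | ‖y‖ ≤ R ∧ M / 2 * t ^ 2 ≤ diff2 u (t • e) y} ≠ ⊤ := by
    refine ne_top_of_le_ne_top (isCompact_closedBall (0 : 𝔼 n) R).measure_lt_top.ne
      (measure_mono fun x hx => mem_closedBall_zero_iff.2 hx.1)
  have hreal : √(ρ ^ n) * κ ≤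
      volume.real {y | ‖y‖ ≤ R ∧ M / 2 * t ^ 2 ≤ diff2 u (t • e) y} := by
    have := ENNReal.toReal_mono hfin (hvol.trans (measure_mono hsub))
    rwa [ENNReal.toReal_mul, ENNReal.toReal_ofReal (Real.sqrt_nonneg _)] at this
  have hρn : ρ ^ n ≤ √(ρ ^ n) := by
    apply Real.le_sqrt_of_sq_le
    have h1 : ρ ≤ 1 := by
      rw [hρ, div_le_one (by positivity)]
      have : (1 : ℝ) ≤ 2 ^ (j + 1) := one_le_pow₀ one_le_two
      linarith
    have h2 : ρ ^ n ≤ 1 := pow_le_one₀ hρ0.le h1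
    have h3 : 0 < ρ ^ n := by positivity
    nlinarith
  have hρn2 : h₀ ^ n / ((1 + η) ^ (j + 1)) ^ N ≤ ρ ^ n := by
    rw [hρ, div_pow]
    gcongr
    rw [← pow_mul, mul_comm, pow_mul, ← pow_mul (1 + η), mul_comm (j + 1), pow_mul]
    gcongr
  set T := (1 + η) ^ (j + 1) with hT
  have hT0 : 0 < T := by positivity
  have hfinal : M / 2 * (h₀ ^ n / T ^ N * κ) ≤ 8 / R ^ 2 * V := by
    refine le_trans ?_ hmeas
    gcongr
    refine le_trans ?_ hreal
    gcongr
    exact hρn2.trans hρn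
  have hM2 : M ≤ T ^ N * (16 * V / (R ^ 2 * κ * h₀ ^ n)) := by
    have e1 : M / 2 * (h₀ ^ n / T ^ N * κ) = M * (h₀ ^ n * κ / (2 * T ^ N)) := by field_simp
    rw [e1, ← le_div_iff₀ (by positivity)] at hfinal
    refine hfinal.trans (le_of_eq ?_)
    field_simp
    ring
  calc s ^ N * M ≤ s ^ N * (T ^ N * (16 * V / (R ^ 2 * κ * h₀ ^ n))) := by gcongr
    _ = (s * T) ^ N * (16 * V / (R ^ 2 * κ * h₀ ^ n)) := by rw [mul_pow]; ring
    _ ≤ _ := by rw [hK₀]; gcongr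

theorem exists_inner_hess_le (hn : 0 < n) : ∃ K : ℝ, 0 < K ∧
    ∀ (u : (𝔼 n) → ℝ) (g : (𝔼 n) → 𝔼 n) (H : (𝔼 n) → (𝔼 n) →L[ℝ] 𝔼 n), Normalized u g H →
    ∀ y, ‖y‖ ≤ estRadius n / 2 → ∀ ξ, ⟪H y ξ, ξ⟫ ≤ K * ‖ξ‖ ^ 2 := by
  obtain ⟨K, hK, hdiff⟩ := exists_diff2_le hn
  refine ⟨K, hK, fun u g H h y hy ξ => ?_⟩
  rcases eq_or_ne ξ 0 with rfl | hξ
  · simp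
  have hξ0 : 0 < ‖ξ‖ := norm_pos_iff.2 hξ
  have h1 : ⟪H y (‖ξ‖⁻¹ • ξ), ‖ξ‖⁻¹ • ξ⟫ ≤ K :=
    h.inner_hess_le_of_diff2_le _ (estRadius_pos hn) fun t ht htR =>
      hdiff u g H h _ (norm_smul_inv_norm hξ) t ht htR y hy
  rw [map_smul, inner_smul_left, inner_smul_right] at h1
  simp only [conj_trivial] at h1
  rw [← mul_assoc, ← mul_inv, inv_mul_le_iff₀ (by positivity)] at h1
  linarith

theorem inner_rescaleHess (H : (𝔼 n) → (𝔼 n) →L[ℝ] 𝔼 n) (x₀ : 𝔼 n) (A : (𝔼 n) →L[ℝ] 𝔼 n) (r : ℝ)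
    (y ξ : 𝔼 n) : ⟪rescaleHess H x₀ A r y ξ, ξ⟫ = r⁻¹ * ⟪H (x₀ + A y) (A ξ), A ξ⟫ := by
  simp [rescaleHess, inner_smul_left, ContinuousLinearMap.adjoint_inner_left]

/-- The Hessian of an entire solution is uniformly bounded. -/
theorem Solution.exists_hess_bounds {u : (𝔼 n) → ℝ} {g : (𝔼 n) → 𝔼 n}
    {H : (𝔼 n) → (𝔼 n) →L[ℝ] 𝔼 n} (hn : 0 < n) (h : Solution u g H) :
    ∃ l Λ : ℝ, 0 < l ∧ 0 < Λ ∧ (∀ x ξ, l * ‖ξ‖ ^ 2 ≤ ⟪H x ξ, ξ⟫) ∧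
      ∀ x ξ, ⟪H x ξ, ξ⟫ ≤ Λ * ‖ξ‖ ^ 2 := by
  obtain ⟨K, hK, hest⟩ := exists_inner_hess_le (n := n) hn
  set b := estRadius n / 2 with hb
  have hb0 : 0 < b := by have := estRadius_pos hn; positivity
  have h0pos : ∀ ξ, 0 ≤ ⟪H 0 ξ, ξ⟫ := fun ξ => (h.isPositive 0).inner_nonneg_left ξ
  have hcomp : ∀ x ξ, ⟪H x ξ, ξ⟫ ≤ K ^ n * ⟪H 0 ξ, ξ⟫ := by
    intro x ξ
    set r := (K ^ (n - 1) * ⟪H 0 x, x⟫) / b ^ 2 + 1 with hr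
    have hr0 : 0 < r := by
      have := h0pos x
      positivity
    obtain ⟨A, hA, hN⟩ := h.exists_normalized hn 0 hr0
    have hbij := bijective_of_det_ne_zero (det_ne_zero_of_sq hr0 hA)
    have hest' := hest _ _ _ hN
    have hlow : ∀ ζ, ‖ζ‖ ^ 2 ≤ K ^ (n - 1) * (r⁻¹ * ⟪H 0 (A ζ), A ζ⟫) := fun ζ => by
      have := norm_sq_le_of_det_eq_one (hN.isPositive 0) (hN.det_eq 0)
        (hest' 0 (by simpa using hb0.le)) ζ
      rw [inner_rescaleHess] at this
      simpa using this
    obtain ⟨y, rfl⟩ := hbij.2 x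
    obtain ⟨ζ, rfl⟩ := hbij.2 ξ
    have hy : ‖y‖ ≤ b := by
      rw [← sq_le_sq₀ (norm_nonneg y) hb0.le]
      refine (hlow y).trans ?_
      rw [mul_left_comm, inv_mul_le_iff₀ hr0, ← div_le_iff₀ (by positivity), hr]
      linarith
    have h1 := hest' y hy ζ
    rw [inner_rescaleHess, zero_add, inv_mul_le_iff₀ hr0] at h1
    refine h1.trans ?_
    have h2 := mul_le_mul_of_nonneg_left (hlow ζ) (by positivity : 0 ≤ r * K)
    rw [← mul_assoc r]
    refine h2.trans (le_of_eq ?_)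
    obtain ⟨m, rfl⟩ : ∃ m, n = m + 1 := ⟨n - 1, by omega⟩
    rw [Nat.add_sub_cancel, pow_succ]
    field_simp
  set Λ := K ^ n * ‖H 0‖ + 1 with hΛ
  have hΛ0 : 0 < Λ := by positivity
  have hup : ∀ x ξ, ⟪H x ξ, ξ⟫ ≤ Λ * ‖ξ‖ ^ 2 := fun x ξ => by
    have h1 : ⟪H 0 ξ, ξ⟫ ≤ ‖H 0‖ * ‖ξ‖ ^ 2 := by
      refine (real_inner_le_norm _ _).trans ?_
      rw [sq, ← mul_assoc]
      gcongr
      exact (H 0).le_opNorm ξ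
    have h2 := mul_le_mul_of_nonneg_left h1 (pow_pos hK n).le
    have h3 := hcomp x ξ
    rw [hΛ]; nlinarith [sq_nonneg ‖ξ‖]
  refine ⟨(Λ ^ (n - 1))⁻¹, Λ, by positivity, hΛ0, fun x ξ => ?_, hup⟩
  rw [inv_mul_le_iff₀ (by positivity)]
  exact norm_sq_le_of_det_eq_one (h.isPositive x) (h.det_eq x) (hup x) ξ

theorem HasHessian.exp {w : (𝔼 n) → ℝ} {g : (𝔼 n) → 𝔼 n} {H : (𝔼 n) → (𝔼 n) →L[ℝ] 𝔼 n}
    (h : HasHessian w g H) (c : ℝ) :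
    HasHessian (fun x => Real.exp (c * w x)) (fun x => (c * Real.exp (c * w x)) • g x)
      (fun x => (c * Real.exp (c * w x)) • H x +
        (innerSL ℝ ((c * (c * Real.exp (c * w x))) • g x)).smulRight (g x)) := by
  have hE : ∀ x, HasFDerivAt (fun x => Real.exp (c * w x))
      (innerSL ℝ ((c * Real.exp (c * w x)) • g x)) x := fun x => by
    refine ((h.grad x).const_mul c).exp.congr_fderiv ?_
    ext y; simp; ring
  refine ⟨hE, fun x => ?_, ?_⟩
  · refine (((hE x).const_mul c).smul (h.hess x)).congr_fderiv ?_
    ext1 y; simp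
    congr 1; ring
  · have := h.cont
    have := h.continuous_grad
    have := h.continuous
    have h1 : Continuous fun x => ContinuousLinearMap.smulRightL ℝ (𝔼 n) (𝔼 n)
        (innerSL ℝ ((c * (c * Real.exp (c * w x))) • g x)) (g x) := by fun_prop
    exact (by fun_prop : Continuous fun x => (c * Real.exp (c * w x)) • H x).add h1

theorem HasHessian.exists_gap_eq {u : (𝔼 n) → ℝ} {g : (𝔼 n) → 𝔼 n}
    {H : (𝔼 n) → (𝔼 n) →L[ℝ] 𝔼 n} (h : HasHessian u g H) (z x : 𝔼 n) :
    ∃ y, gap u g z x = ⟪H y (x - z), x - z⟫ / 2 := by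
  set e := x - z with he
  have d1 : ∀ s : ℝ, HasDerivAt (fun s : ℝ => u (z + s • e) - u z - s * ⟪g z, e⟫)
      (⟪g (z + s • e), e⟫ - ⟪g z, e⟫) s := fun s => by
    have := ((h.hasDerivAt_line z e s).sub_const (u z)).sub
      ((hasDerivAt_id s).mul_const ⟪g z, e⟫)
    rw [one_mul] at this
    exact this
  have d2 : ∀ s : ℝ, HasDerivAt (fun s : ℝ => ⟪g (z + s • e), e⟫ - ⟪g z, e⟫)
      ⟪H (z + s • e) e, e⟫ s := fun s => (h.hasDerivAt_line_grad z e e s).sub_const _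
  have dsq : ∀ s : ℝ, HasDerivAt (fun s : ℝ => s ^ 2) (2 * s) s := fun s => by
    simpa using hasDerivAt_pow 2 s
  obtain ⟨s, hs, h1⟩ := exists_ratio_hasDerivAt_eq_ratio_slope _ _ (zero_lt_one' ℝ)
    (fun x _ => (d1 x).continuousAt.continuousWithinAt) (fun x _ => d1 x) _ _
    (fun x _ => (dsq x).continuousAt.continuousWithinAt) (fun x _ => dsq x)
  obtain ⟨ζ, hζ, h2⟩ := exists_hasDerivAt_eq_slope _ _ hs.1
    (fun x _ => (d2 x).continuousAt.continuousWithinAt) (fun x _ => d2 x)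
  refine ⟨z + ζ • e, ?_⟩
  have hs0 := hs.1
  have hx : z + e = x := by rw [he]; abel
  simp only [zero_smul, add_zero, sub_zero, sub_self, one_smul, zero_mul, one_mul, hx] at h1 h2
  rw [h2, gap, ← he]
  field_simp
  linarith

theorem HasHessian.exists_inner_grad_sub_eq {u : (𝔼 n) → ℝ} {g : (𝔼 n) → 𝔼 n}
    {H : (𝔼 n) → (𝔼 n) →L[ℝ] 𝔼 n} (h : HasHessian u g H) (z x : 𝔼 n) :
    ∃ y, ⟪g x - g z, x - z⟫ = ⟪H y (x - z), x - z⟫ := by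
  set e := x - z with he
  have d2 : ∀ s : ℝ, HasDerivAt (fun s : ℝ => ⟪g (z + s • e), e⟫)
      ⟪H (z + s • e) e, e⟫ s := fun s => h.hasDerivAt_line_grad z e e s
  obtain ⟨ζ, hζ, h2⟩ := exists_hasDerivAt_eq_slope _ _ (zero_lt_one' ℝ)
    (fun x _ => (d2 x).continuousAt.continuousWithinAt) (fun x _ => d2 x)
  refine ⟨z + ζ • e, ?_⟩
  have hx : z + e = x := by rw [he]; abel
  simp only [zero_smul, add_zero, sub_zero, one_smul, hx, div_one] at h2
  rw [h2, inner_sub_left]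

/-- A solution with uniformly bounded Hessian. -/
structure UniformSolution (u : (𝔼 n) → ℝ) (g : (𝔼 n) → 𝔼 n) (H : (𝔼 n) → (𝔼 n) →L[ℝ] 𝔼 n)
    (l Λ : ℝ) : Prop extends Solution u g H where
  l_pos : 0 < l
  pos : 0 < Λ
  le_hess : ∀ x ξ, l * ‖ξ‖ ^ 2 ≤ ⟪H x ξ, ξ⟫
  hess_le : ∀ x ξ, ⟪H x ξ, ξ⟫ ≤ Λ * ‖ξ‖ ^ 2

namespace UniformSolution

variable {u v : (𝔼 n) → ℝ} {g gv : (𝔼 n) → 𝔼 n} {H Hv : (𝔼 n) → (𝔼 n) →L[ℝ] 𝔼 n} {l Λ : ℝ}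

theorem le_gap (h : UniformSolution u g H l Λ) (z x : 𝔼 n) :
    l / 2 * ‖x - z‖ ^ 2 ≤ gap u g z x := by
  obtain ⟨y, hy⟩ := h.exists_gap_eq z x
  have := h.le_hess y (x - z)
  rw [hy]; linarith

theorem gap_le (h : UniformSolution u g H l Λ) (z x : 𝔼 n) :
    gap u g z x ≤ Λ / 2 * ‖x - z‖ ^ 2 := by
  obtain ⟨y, hy⟩ := h.exists_gap_eq z x
  have := h.hess_le y (x - z)
  rw [hy]; linarith

theorem le_norm_grad_sub (h : UniformSolution u g H l Λ) (z x : 𝔼 n) :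
    l * ‖x - z‖ ≤ ‖g x - g z‖ := by
  rcases eq_or_ne (x - z) 0 with h0 | h0
  · rw [h0]; simp
  have hpos : 0 < ‖x - z‖ := norm_pos_iff.2 h0
  obtain ⟨y, hy⟩ := h.exists_inner_grad_sub_eq z x
  have h1 := h.le_hess y (x - z)
  have h2 := real_inner_le_norm (g x - g z) (x - z)
  nlinarith

/-- Measure estimate in balls. -/
theorem exists_volume_ball_ge (hn : 0 < n) (h : UniformSolution u g H l Λ) :
    ∃ c : ℝ, 0 < c ∧ ∀ v gv Hv, HasHessian v gv Hv → IsSuper H Hv → (∀ x, 0 ≤ v x) →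
    ∀ x r t, 0 < r → 0 < t → v x ≤ t →
      ENNReal.ofReal (c * r ^ n) ≤ volume (Metric.closedBall x r ∩ {y | v y ≤ 3 / 2 * t}) := by
  have hC := secRadius_pos hn
  set κ := volume.real (Metric.closedBall (0 : 𝔼 n) (1 / (4 * secRadius n))) with hκ
  have hκ0 : 0 < κ := by
    refine ENNReal.toReal_pos (Metric.measure_closedBall_pos _ _ (by positivity)).ne'
      (isCompact_closedBall _ _).measure_lt_top.ne
  have hl := h.l_pos
  refine ⟨√((l / 2) ^ n) * κ, by positivity, ?_⟩
  intro v gv Hv hv hvs hv0 x r t hr ht hvx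
  have hρ : 0 < l / 2 * r ^ 2 := by positivity
  have h1 := h.volume_section_ge hn hv hvs hρ ht (fun y _ => hv0 y) hvx
  refine le_trans (le_of_eq ?_) (h1.trans (measure_mono ?_))
  · have e1 : √((l / 2 * r ^ 2) ^ n) = √((l / 2) ^ n) * r ^ n := by
      rw [mul_pow, Real.sqrt_mul (by positivity), ← pow_mul, mul_comm 2, pow_mul,
        Real.sqrt_sq (by positivity)]
    rw [e1, mul_right_comm, ENNReal.ofReal_mul (by positivity), hκ, measureReal_def,
      ENNReal.ofReal_toReal (isCompact_closedBall _ _).measure_lt_top.ne]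
  · rintro y ⟨hy1, hy2⟩
    refine ⟨?_, hy2⟩
    have := (h.le_gap x y).trans hy1
    have h2 := le_of_mul_le_mul_left this (by positivity)
    rw [mem_closedBall_iff_norm]
    exact (sq_le_sq₀ (norm_nonneg _) hr.le).1 h2

set_option maxHeartbeats 800000 in
/-- A supersolution that is small at one point is not much larger somewhere in any nearby ball. -/
theorem exists_mem_closedBall_le (hn : 0 < n) (h : UniformSolution u g H l Λ) :
    ∃ K : ℝ, 1 ≤ K ∧ ∀ v gv Hv, HasHessian v gv Hv → IsSuper H Hv → (∀ x, 0 ≤ v x) →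
    ∀ z x r t, 0 < r → 0 < t → v x ≤ t → ‖x - z‖ ≤ 12 * r →
      ∃ y ∈ Metric.closedBall z r, v y ≤ K * t := by
  have hl := h.l_pos
  have hΛ := h.pos
  set m : ℝ := (n + 1) * Λ ^ 2 / l ^ 2 with hm
  have hm0 : 0 < m := by positivity
  set κ := Real.exp (-(72 * m)) - Real.exp (-(144 * m)) with hκ
  have hκ0 : 0 < κ := sub_pos.2 (Real.exp_lt_exp.2 (by linarith))
  refine ⟨1 + κ⁻¹, by have : 0 < κ⁻¹ := inv_pos.2 hκ0
                      linarith, ?_⟩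
  set K := 1 + κ⁻¹ with hK
  have hKκ : 1 < K * κ := by rw [hK, add_mul, inv_mul_cancel₀ hκ0.ne']; linarith
  have hK0 : 0 < K := by have : 0 < κ⁻¹ := inv_pos.2 hκ0
                         linarith
  intro v gv Hv hv hvs hv0 z x r t hr ht hvx hxz
  by_contra! hbig
  have hτ : 0 < K * t := by positivity
  set τ := K * t with hτd
  set μ : ℝ := m / (Λ * r ^ 2) with hμ
  have hμ0 : 0 < μ := by positivity
  set S : ℝ := 144 * Λ * r ^ 2 with hS
  have hS0 : 0 < S := by positivity
  have hμS : μ * S = 144 * m := by rw [hμ, hS]; field_simp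
  have hq := h.hasHessian_gap z
  have hcq := h.continuous_gap z
  have hcv := hv.continuous
  have hψ := hv.add ((hq.exp (-μ)).const_smul (-τ))
  set ψ : (𝔼 n) → ℝ := fun y => v y + -τ * Real.exp (-μ * gap u g z y) with hψd
  have hcψ : Continuous ψ := hψ.continuous
  have hD : IsCompact ({y | gap u g z y ≤ S} ∩ {y | r ≤ ‖y - z‖}) :=
    (h.isCompact_section hn z hS0).inter_right
      (isClosed_le continuous_const (by fun_prop))
  have hxr : r < ‖x - z‖ := by
    by_contra! hle
    have h1 := hbig x (mem_closedBall_iff_norm.2 hle)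
    have : t ≤ τ := by
      have : 0 < κ⁻¹ := inv_pos.2 hκ0
      rw [hτd, hK]; nlinarith
    linarith
  have hxq : gap u g z x ≤ 72 * Λ * r ^ 2 := by
    refine (h.gap_le z x).trans ?_
    have : ‖x - z‖ ^ 2 ≤ (12 * r) ^ 2 := by gcongr
    nlinarith
  have hxD : x ∈ {y | gap u g z y ≤ S} ∩ {y | r ≤ ‖y - z‖} :=
    ⟨hxq.trans (by rw [hS]; nlinarith [sq_nonneg r]), hxr.le⟩
  obtain ⟨y, ⟨hyS, hyr⟩, hmin⟩ := hD.exists_isMinOn ⟨x, hxD⟩ hcψ.continuousOn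
  have hψx : ψ x < -τ * Real.exp (-(144 * m)) := by
    have h1 : Real.exp (-(72 * m)) ≤ Real.exp (-μ * gap u g z x) := by
      apply Real.exp_le_exp.2
      have : μ * gap u g z x ≤ μ * (72 * Λ * r ^ 2) := by gcongr
      have e : μ * (72 * Λ * r ^ 2) = 72 * m := by rw [hμ]; field_simp
      linarith
    have h2 : t < τ * κ := by
      rw [hτd]; nlinarith
    have h3 := mul_le_mul_of_nonneg_left h1 hτ.le
    rw [hκ, mul_sub] at h2
    simp only [hψd]
    linarith
  have hyx : ψ y ≤ ψ x := hmin hxD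
  have hyS' : gap u g z y < S := by
    refine lt_of_le_of_ne hyS fun heq => ?_
    have h1 : ψ y = v y + -τ * Real.exp (-(144 * m)) := by
      simp only [hψd]; rw [heq, neg_mul μ, hμS]
    have := hv0 y
    linarith
  have hyr' : r < ‖y - z‖ := by
    refine lt_of_le_of_ne hyr fun heq => ?_
    have h1 := hbig y (mem_closedBall_iff_norm.2 heq.symm.le)
    have h2 : Real.exp (-μ * gap u g z y) ≤ 1 := by
      rw [Real.exp_le_one_iff]
      have := h.gap_nonneg z y
      nlinarith
    have h3 : 0 ≤ ψ y := by simp only [hψd]; nlinarith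
    have h4 := Real.exp_pos (-(144 * m))
    nlinarith
  have hloc : IsLocalMin ψ y := by
    have h1 := (isOpen_lt hcq continuous_const).mem_nhds hyS'
    have h2 := (isOpen_lt continuous_const (by fun_prop : Continuous fun y => ‖y - z‖)).mem_nhds
      hyr'
    filter_upwards [h1, h2] with a ha1 ha2
    exact hmin ⟨le_of_lt ha1, le_of_lt ha2⟩
  have hpos := hψ.isPositive_of_isLocalMin hloc
  obtain ⟨b, hb⟩ := exists_isFrame (h.isPositive y) (h.det_eq y)
  have hsup := hvs y b hb
  set E := Real.exp (-μ * gap u g z y) with hE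
  have hE0 : 0 < E := Real.exp_pos _
  have hsum : 0 ≤ ∑ i, ⟪Hv y (b i), b i⟫ +
      (τ * μ * E * ∑ i, ⟪H y (b i), b i⟫ - τ * μ ^ 2 * E * ∑ i, ⟪g y - g z, b i⟫ ^ 2) := by
    rw [Finset.mul_sum, Finset.mul_sum, ← Finset.sum_sub_distrib, ← Finset.sum_add_distrib]
    refine Finset.sum_nonneg fun i _ => ?_
    have := hpos.inner_nonneg_left (b i)
    simp only [add_apply, smul_apply, ContinuousLinearMap.smulRight_apply, innerSL_apply_apply,
      inner_add_left, inner_smul_left, conj_trivial] at this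
    refine this.trans (le_of_eq ?_)
    ring
  have hlow := hb.norm_sq_le Λ (h.hess_le y) (g y - g z)
  rw [hb.sum_self] at hsum
  have hgr := h.le_norm_grad_sub z y
  have h1 : (l * r) ^ 2 ≤ ‖g y - g z‖ ^ 2 := by
    gcongr
    refine le_trans ?_ hgr
    gcongr
  have h2 : n < μ * ∑ i, ⟪g y - g z, b i⟫ ^ 2 := by
    have h3 : (l * r) ^ 2 / Λ ≤ ∑ i, ⟪g y - g z, b i⟫ ^ 2 := by
      rw [div_le_iff₀ hΛ]; linarith
    have h4 := mul_le_mul_of_nonneg_left h3 hμ0.le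
    have h5 : μ * ((l * r) ^ 2 / Λ) = n + 1 := by rw [hμ, hm]; field_simp
    linarith
  have h3 : 0 < τ * μ * E * (μ * ∑ i, ⟪g y - g z, b i⟫ ^ 2 - n) := by
    have := sub_pos.2 h2
    positivity
  nlinarith

end UniformSolution

/-- A Vitali covering estimate: if `B` has density at least `c` at the scale `r z` around each point
`z` of `A`, then the volume of `A` is controlled by that of `B`. -/
theorem volume_le_of_forall_le_closedBall_inter {A B : Set (𝔼 n)} (hB : MeasurableSet B)
    {r : (𝔼 n) → ℝ} {R c : ℝ} (hc : 0 < c) (hr : ∀ z ∈ A, 0 < r z) (hrR : ∀ z ∈ A, r z ≤ R)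
    (h : ∀ z ∈ A, ENNReal.ofReal (c * r z ^ n) ≤ volume (Metric.closedBall z (r z) ∩ B)) :
    volume A ≤ ENNReal.ofReal (5 ^ n / c) * volume (Metric.ball (0 : 𝔼 n) 1) * volume B := by
  obtain ⟨s, hsA, hsd, hs⟩ := Vitali.exists_disjoint_subfamily_covering_enlargement_closedBall
    A id r R hrR 5 (by norm_num)
  simp only [id] at hsd hs
  have hcount : s.Countable := hsd.countable_of_nonempty_interior fun z hz =>
    (Metric.nonempty_ball.2 (hr z (hsA hz))).mono Metric.ball_subset_interior_closedBall
  have hcov : A ⊆ ⋃ z ∈ s, Metric.closedBall z (5 * r z) := fun z hz => by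
    obtain ⟨b, hb, hsub⟩ := hs z hz
    exact mem_biUnion hb (hsub (Metric.mem_closedBall_self (hr z hz).le))
  calc volume A ≤ ∑' z : s, volume (Metric.closedBall (z : 𝔼 n) (5 * r z)) :=
        (measure_mono hcov).trans (measure_biUnion_le _ hcount _)
    _ ≤ ∑' z : s, ENNReal.ofReal (5 ^ n / c) * volume (Metric.ball (0 : 𝔼 n) 1) *
          volume (Metric.closedBall (z : 𝔼 n) (r z) ∩ B) := by
        refine ENNReal.tsum_le_tsum fun z => ?_
        have hz := hr z (hsA z.2)
        rw [Measure.addHaar_closedBall _ _ (by positivity), finrank_euclideanSpace_fin,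
          mul_right_comm]
        gcongr
        calc ENNReal.ofReal ((5 * r z) ^ n)
            = ENNReal.ofReal (5 ^ n / c) * ENNReal.ofReal (c * r z ^ n) := by
              rw [← ENNReal.ofReal_mul (by positivity)]
              congr 1
              rw [mul_pow]
              field_simp
          _ ≤ _ := by gcongr; exact h z (hsA z.2)
    _ = ENNReal.ofReal (5 ^ n / c) * volume (Metric.ball (0 : 𝔼 n) 1) *
          volume (⋃ z ∈ s, Metric.closedBall z (r z) ∩ B) := by
        rw [ENNReal.tsum_mul_left, measure_biUnion hcount
          (hsd.mono_on fun z _ => inter_subset_left)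
          fun z _ => Metric.isClosed_closedBall.measurableSet.inter hB]
    _ ≤ _ := by
        gcongr
        exact iUnion₂_subset fun z _ => inter_subset_right

namespace UniformSolution

variable {u : (𝔼 n) → ℝ} {g : (𝔼 n) → 𝔼 n} {H : (𝔼 n) → (𝔼 n) →L[ℝ] 𝔼 n} {l Λ : ℝ}

theorem exists_volume_diff_le (hn : 0 < n) (h : UniformSolution u g H l Λ) :
    ∃ K θ : ℝ, 1 ≤ K ∧ 0 ≤ θ ∧ θ < 1 ∧
    ∀ v gv Hv, HasHessian v gv Hv → IsSuper H Hv → (∀ x, 0 ≤ v x) →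
    ∀ x R t, 0 < t → v x ≤ t →
      volume.real (Metric.closedBall x R ∩ {y | K * t < v y}) ≤
        θ * volume.real (Metric.closedBall x R ∩ {y | t < v y}) := by
  obtain ⟨c, hc, hvol⟩ := h.exists_volume_ball_ge hn
  obtain ⟨K, hK, hmem⟩ := h.exists_mem_closedBall_le hn
  set D : ENNReal := ENNReal.ofReal (5 ^ n / (c / 8 ^ n)) * volume (Metric.ball (0 : 𝔼 n) 1) with hD
  have hDtop : D ≠ ⊤ := ENNReal.mul_ne_top ENNReal.ofReal_ne_top measure_ball_lt_top.ne
  set d := D.toReal with hd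
  have hd0 : 0 ≤ d := ENNReal.toReal_nonneg
  refine ⟨3 / 2 * K, d / (d + 1), by linarith, by positivity, by
    rw [div_lt_one (by positivity)]; linarith, ?_⟩
  intro v gv Hv hv hvs hv0 x R t ht hvx
  have hvc : Continuous v := hv.continuous
  set G := {y | v y ≤ t} with hG
  have hGc : IsClosed G := isClosed_le hvc continuous_const
  have hGne : G.Nonempty := ⟨x, hvx⟩
  set A := Metric.closedBall x R ∩ {y | t < v y} with hA
  set B := A ∩ {y | v y ≤ 3 / 2 * K * t} with hB
  have hAm : MeasurableSet A := Metric.isClosed_closedBall.measurableSet.inter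
    (isOpen_lt continuous_const hvc).measurableSet
  have hLm : MeasurableSet {y | v y ≤ 3 / 2 * K * t} :=
    (isClosed_le hvc continuous_const).measurableSet
  have hpos : ∀ z ∈ A, 0 < Metric.infDist z G := fun z hz =>
    (hGc.notMem_iff_infDist_pos hGne).1 fun hzG : v z ≤ t => hzG.not_gt hz.2
  have hle : ∀ z, Metric.infDist z G ≤ dist z x := fun z => Metric.infDist_le_dist_of_mem hvx
  have hcov : volume A ≤ D * volume B := by
    refine volume_le_of_forall_le_closedBall_inter (hAm.inter hLm) (R := R)
      (r := fun z => Metric.infDist z G) (c := c / 8 ^ n) (by positivity) hpos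
      (fun z hz => (hle z).trans hz.1) ?_
    intro z hz
    have hr := hpos z hz
    set r := Metric.infDist z G with hr_def
    obtain ⟨w, hwG, hw⟩ := hGc.exists_infDist_eq_dist hGne z
    have hrD : r ≤ ‖z - x‖ := by rw [← dist_eq_norm]; exact hle z
    have hDR : ‖z - x‖ ≤ R := mem_closedBall_iff_norm.1 hz.1
    have hD0 : 0 < ‖z - x‖ := hr.trans_le hrD
    set s := r / (2 * ‖z - x‖) with hs
    set p := z - s • (z - x) with hp
    have hs0 : 0 < s := by positivity
    have hsD : s * ‖z - x‖ = r / 2 := by rw [hs]; field_simp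
    have hpz : ‖p - z‖ = r / 2 := by
      rw [hp, sub_sub_cancel_left, norm_neg, norm_smul, Real.norm_of_nonneg hs0.le, hsD]
    have hpx : ‖p - x‖ = ‖z - x‖ - r / 2 := by
      have : p - x = (1 - s) • (z - x) := by rw [hp]; module
      have h1 : 0 ≤ 1 - s := by
        have : s ≤ 1 := by rw [hs, div_le_one (by positivity)]; linarith
        linarith
      rw [this, norm_smul, Real.norm_of_nonneg h1, sub_mul, one_mul, hsD]
    have hwp : ‖w - p‖ ≤ 12 * (r / 8) := by
      have h1 : ‖w - z‖ = r := by rw [← dist_eq_norm, dist_comm, ← hw]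
      have h2 := norm_sub_le_norm_sub_add_norm_sub w z p
      rw [norm_sub_rev z p] at h2
      linarith
    obtain ⟨y, hy, hvy⟩ := hmem v gv Hv hv hvs hv0 p w (r / 8) t (by positivity) ht hwG hwp
    have h1 := hvol v gv Hv hv hvs hv0 y (r / 8) (K * t) (by positivity) (by positivity) hvy
    have hyp := mem_closedBall_iff_norm.1 hy
    refine le_trans (le_of_eq ?_) (h1.trans (measure_mono ?_))
    · congr 1
      rw [div_pow]; ring
    · rintro q ⟨hq, hvq⟩
      have hqy := mem_closedBall_iff_norm.1 hq
      have hqp : ‖q - p‖ ≤ r / 4 := by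
        have := norm_sub_le_norm_sub_add_norm_sub q y p
        linarith
      have hqz : ‖q - z‖ ≤ r / 2 + r / 4 := by
        have := norm_sub_le_norm_sub_add_norm_sub q p z
        linarith
      have hqx : ‖q - x‖ ≤ R := by
        have := norm_sub_le_norm_sub_add_norm_sub q p x
        linarith
      refine ⟨mem_closedBall_iff_norm.2 (by linarith), ⟨mem_closedBall_iff_norm.2 hqx, ?_⟩, ?_⟩
      · show t < v q
        by_contra! hcon
        have h2 : r ≤ dist z q := Metric.infDist_le_dist_of_mem (show q ∈ G from hcon)
        rw [dist_comm, dist_eq_norm] at h2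
        linarith
      · show v q ≤ 3 / 2 * K * t
        have : v q ≤ 3 / 2 * (K * t) := hvq
        linarith
  have hAtop : volume A ≠ ⊤ :=
    ((measure_mono inter_subset_left).trans_lt measure_closedBall_lt_top).ne
  have hBtop : volume B ≠ ⊤ := ((measure_mono inter_subset_left).trans_lt hAtop.lt_top).ne
  have hcov' : volume.real A ≤ d * volume.real B := by
    have := ENNReal.toReal_mono (ENNReal.mul_ne_top hDtop hBtop) hcov
    rwa [ENNReal.toReal_mul] at this
  have hsplit := measureReal_inter_add_sdiff (μ := volume) (s := A) hLm hAtop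
  have hset : A \ {y | v y ≤ 3 / 2 * K * t} =
      Metric.closedBall x R ∩ {y | 3 / 2 * K * t < v y} := by
    ext q
    simp only [hA, Set.mem_sdiff, mem_inter_iff, mem_ofPred_eq, not_le]
    constructor
    · rintro ⟨⟨h1, _⟩, h2⟩; exact ⟨h1, h2⟩
    · rintro ⟨h1, h2⟩
      refine ⟨⟨h1, ?_⟩, h2⟩
      nlinarith
  rw [hset] at hsplit
  have hB0 : 0 ≤ volume.real B := measureReal_nonneg
  change volume.real B + _ = _ at hsplit
  rw [div_mul_eq_mul_div d, le_div_iff₀ (by positivity), ← hsplit]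
  rw [← hsplit] at hcov'
  linarith

/-- A nonnegative supersolution is comparable to its value at a point on most of every ball around
this point. -/
theorem exists_volume_gt_le (hn : 0 < n) (h : UniformSolution u g H l Λ) {ε : ℝ} (hε : 0 < ε) :
    ∃ L : ℝ, 0 < L ∧ ∀ v gv Hv, HasHessian v gv Hv → IsSuper H Hv → (∀ x, 0 ≤ v x) →
    ∀ x R t, 0 < t → v x ≤ t →
      volume.real (Metric.closedBall x R ∩ {y | L * t < v y}) ≤
        ε * volume.real (Metric.closedBall x R) := by
  obtain ⟨K, θ, hK, hθ0, hθ1, hdiff⟩ := h.exists_volume_diff_le hn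
  obtain ⟨k, hk⟩ := exists_pow_lt_of_lt_one hε hθ1
  refine ⟨K ^ k, by positivity, fun v gv Hv hv hvs hv0 x R t ht hvx => ?_⟩
  have key : ∀ j : ℕ, volume.real (Metric.closedBall x R ∩ {y | K ^ j * t < v y}) ≤
      θ ^ j * volume.real (Metric.closedBall x R) := by
    intro j
    induction j with
    | zero =>
      simp only [pow_zero, one_mul]
      exact measureReal_mono inter_subset_left
        (measure_closedBall_lt_top (μ := (volume : Measure (𝔼 n)))).ne
    | succ j ih =>
      have h1 : 1 ≤ K ^ j := one_le_pow₀ hK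
      have := hdiff v gv Hv hv hvs hv0 x R (K ^ j * t) (by positivity) (by nlinarith)
      rw [pow_succ', pow_succ', mul_assoc, mul_assoc]
      exact this.trans (mul_le_mul_of_nonneg_left ih hθ0)
  exact (key k).trans (by gcongr)

end UniformSolution

/-- On a compact set the second difference quotients converge uniformly. -/
theorem HasHessian.exists_abs_diff2_sub_le {u : (𝔼 n) → ℝ} {g : (𝔼 n) → 𝔼 n}
    {H : (𝔼 n) → (𝔼 n) →L[ℝ] 𝔼 n} (h : HasHessian u g H) (e : 𝔼 n) (R : ℝ) {η : ℝ} (hη : 0 < η) :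
    ∃ t : ℝ, 0 < t ∧ ∀ y ∈ Metric.closedBall (0 : 𝔼 n) R,
      |(t ^ 2)⁻¹ * diff2 u (t • e) y - ⟪H y e, e⟫| ≤ η := by
  have hc : Continuous fun y => ⟪H y e, e⟫ :=
    (h.cont.clm_apply continuous_const).inner continuous_const
  have huc := (isCompact_closedBall (0 : 𝔼 n) (R + 1)).uniformContinuousOn_of_continuous
    hc.continuousOn
  obtain ⟨δ, hδ, hδ'⟩ := Metric.uniformContinuousOn_iff_le.1 huc η hη
  set τ := min δ 1 / (‖e‖ + 1) with hτ
  have hm : 0 < min δ 1 := lt_min hδ one_pos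
  have hτ0 : 0 < τ := by positivity
  refine ⟨τ, hτ0, fun y hy => ?_⟩
  obtain ⟨ζ, hζ, heq⟩ := h.exists_diff2_eq e y hτ0
  have hyR := mem_closedBall_zero_iff.1 hy
  have hζe : ‖ζ • e‖ ≤ min δ 1 := by
    rw [norm_smul, Real.norm_of_nonneg hζ.1.le]
    calc ζ * ‖e‖ ≤ τ * (‖e‖ + 1) := by
          gcongr
          · exact hζ.2.le
          · linarith
      _ = min δ 1 := by rw [hτ]; field_simp
  have hy1 : y ∈ Metric.closedBall (0 : 𝔼 n) (R + 1) := mem_closedBall_zero_iff.2 (by linarith)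
  have hζ1 := hζe.trans (min_le_right _ _)
  have hp := hδ' (y + ζ • e) (mem_closedBall_zero_iff.2
    ((norm_add_le _ _).trans (by linarith))) y hy1 (by
      rw [dist_eq_norm, add_sub_cancel_left]; exact hζe.trans (min_le_left _ _))
  have hq := hδ' (y - ζ • e) (mem_closedBall_zero_iff.2
    ((norm_sub_le _ _).trans (by linarith))) y hy1 (by
      rw [dist_eq_norm, sub_sub_cancel_left, norm_neg]; exact hζe.trans (min_le_left _ _))
  rw [Real.dist_eq, abs_le] at hp hq
  rw [heq, inv_mul_cancel_left₀ (by positivity), abs_le]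
  constructor <;> linarith

namespace UniformSolution

variable {u : (𝔼 n) → ℝ} {g : (𝔼 n) → 𝔼 n} {H : (𝔼 n) → (𝔼 n) →L[ℝ] 𝔼 n} {l Λ : ℝ}

/-- On large balls, the second derivative in a given direction is close to its supremum on most of
the ball. -/
theorem exists_forall_volume_lt_le (hn : 0 < n) (h : UniformSolution u g H l Λ) (e : 𝔼 n) {M : ℝ}
    (hM : IsLUB (range fun x => ⟪H x e, e⟫) M) {δ ε : ℝ} (hδ : 0 < δ) (hε : 0 < ε) :
    ∃ R₀ : ℝ, ∀ R, R₀ ≤ R →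
      volume.real (Metric.closedBall (0 : 𝔼 n) R ∩ {y | ⟪H y e, e⟫ < M - δ}) ≤
        ε * volume.real (Metric.closedBall (0 : 𝔼 n) R) := by
  obtain ⟨L, hL, hvol⟩ := h.exists_volume_gt_le hn (ε := ε / 2 ^ n) (by positivity)
  obtain ⟨_, ⟨x, rfl⟩, hx, -⟩ := hM.exists_between
    (sub_lt_self M (show 0 < δ / (4 * L) by positivity))
  refine ⟨‖x‖, fun R hR => ?_⟩
  have hR0 : 0 ≤ R := (norm_nonneg x).trans hR
  obtain ⟨t, ht, hdiff⟩ := h.exists_abs_diff2_sub_le e R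
    (η := min (δ / (4 * L)) (δ / 2)) (by positivity)
  obtain ⟨gv, Hv, hv, hvs⟩ := h.exists_isSuper_sub_diff2 M (c := (t ^ 2)⁻¹) (by positivity) (t • e)
  have hv0 : ∀ y, 0 ≤ M - (t ^ 2)⁻¹ * diff2 u (t • e) y := fun y => by
    obtain ⟨ζ, -, heq⟩ := h.exists_diff2_eq e y ht
    rw [heq, inv_mul_cancel_left₀ (by positivity)]
    have h1 : ⟪H (y + ζ • e) e, e⟫ ≤ M := hM.1 (mem_range_self _)
    have h2 : ⟪H (y - ζ • e) e, e⟫ ≤ M := hM.1 (mem_range_self _)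
    linarith
  have hvx : M - (t ^ 2)⁻¹ * diff2 u (t • e) x ≤ δ / (2 * L) := by
    have h1 := (abs_le.1 (hdiff x (mem_closedBall_zero_iff.2 hR))).1
    have h2 := min_le_left (δ / (4 * L)) (δ / 2)
    have h3 : δ / (2 * L) = δ / (4 * L) + δ / (4 * L) := by field_simp; norm_num
    linarith
  have key := hvol _ gv Hv hv hvs hv0 x (2 * R) (δ / (2 * L)) (by positivity) hvx
  have hball : volume.real (Metric.closedBall x (2 * R)) =
      2 ^ n * volume.real (Metric.closedBall (0 : 𝔼 n) R) := by
    rw [Measure.addHaar_real_closedBall _ _ (by positivity),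
      Measure.addHaar_real_closedBall _ _ hR0, finrank_euclideanSpace_fin, mul_pow, mul_assoc]
  rw [hball] at key
  refine le_trans (measureReal_mono ?_ ?_) (key.trans (le_of_eq (by field_simp)))
  · rintro y ⟨hy, hyM⟩
    have hyR := mem_closedBall_zero_iff.1 hy
    refine ⟨mem_closedBall_iff_norm.2 ((norm_sub_le _ _).trans (by linarith)), ?_⟩
    have h1 := (abs_le.1 (hdiff y hy)).2
    have h2 := min_le_right (δ / (4 * L)) (δ / 2)
    have h3 : L * (δ / (2 * L)) = δ / 2 := by field_simp
    show L * (δ / (2 * L)) < _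
    rw [h3]
    have : ⟪H y e, e⟫ < M - δ := hyM
    linarith
  · exact ((measure_mono inter_subset_left).trans_lt
      (measure_closedBall_lt_top (μ := (volume : Measure (𝔼 n))))).ne

/-- The suprema of finitely many second directional derivatives are almost attained
simultaneously. -/
theorem exists_forall_le_inner_hess (hn : 0 < n) (h : UniformSolution u g H l Λ) {M : (𝔼 n) → ℝ}
    (hM : ∀ e, IsLUB (range fun x => ⟪H x e, e⟫) (M e)) (F : Finset ((𝔼 n) × ↥(Ioi (0 : ℝ)))) :
    ∃ x, ∀ p ∈ F, M p.1 - p.2 ≤ ⟪H x p.1, p.1⟫ := by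
  by_contra! hcon
  set ε : ℝ := 1 / (F.card + 1) with hε
  choose R₀ hR₀ using fun p : (𝔼 n) × ↥(Ioi (0 : ℝ)) =>
    h.exists_forall_volume_lt_le hn p.1 (hM p.1) p.2.2 (show 0 < ε by positivity)
  set R := 1 + ∑ p ∈ F, |R₀ p| with hR
  have hRp : ∀ p ∈ F, R₀ p ≤ R := fun p hp => by
    have := Finset.single_le_sum (fun q _ => abs_nonneg (R₀ q)) hp
    have h2 := le_abs_self (R₀ p)
    linarith
  have hR0 : 0 < R := by
    have := Finset.sum_nonneg fun q (_ : q ∈ F) => abs_nonneg (R₀ q)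
    linarith
  have hlt : volume (Metric.closedBall (0 : 𝔼 n) R) ≠ ⊤ :=
    (measure_closedBall_lt_top (μ := (volume : Measure (𝔼 n)))).ne
  have hpos : 0 < volume.real (Metric.closedBall (0 : 𝔼 n) R) :=
    ENNReal.toReal_pos (Metric.measure_closedBall_pos _ _ hR0).ne' hlt
  have hsub : Metric.closedBall (0 : 𝔼 n) R ⊆
      ⋃ p ∈ F, Metric.closedBall (0 : 𝔼 n) R ∩ {y | ⟪H y p.1, p.1⟫ < M p.1 - p.2} := fun y hy => by
    obtain ⟨p, hp, hlt⟩ := hcon y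
    exact mem_biUnion hp ⟨hy, hlt⟩
  have h1 : volume.real (Metric.closedBall (0 : 𝔼 n) R) ≤
      ∑ p ∈ F, ε * volume.real (Metric.closedBall (0 : 𝔼 n) R) :=
    (measureReal_mono hsub (ne_top_of_le_ne_top hlt
      (measure_mono (iUnion₂_subset fun p _ => inter_subset_left)))).trans
      ((measureReal_biUnion_finset_le _ _).trans
        (Finset.sum_le_sum fun p hp => hR₀ p R (hRp p hp)))
  rw [Finset.sum_const, nsmul_eq_mul, ← mul_assoc] at h1
  have h2 : (F.card : ℝ) * ε < 1 := by
    rw [hε, mul_one_div, div_lt_one (by positivity)]; linarith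
  nlinarith

theorem norm_hess_le (h : UniformSolution u g H l Λ) (x : 𝔼 n) : ‖H x‖ ≤ 2 * Λ := by
  have hΛ := h.pos
  refine ContinuousLinearMap.opNorm_le_bound _ (by positivity) fun ξ => ?_
  set w := H x ξ with hw
  have h1 := h.hess_le x (ξ + (1 / (2 * Λ)) • w)
  have h2 := (h.isPositive x).inner_nonneg_left ξ
  have h3 := (h.isPositive x).inner_nonneg_left ((1 / (2 * Λ)) • w)
  have h4 := (h.isPositive x).inner_left_eq_inner_right w ξ
  have h5 := norm_add_sq_real ξ ((1 / (2 * Λ)) • w)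
  have h6 := norm_sub_sq_real ξ ((1 / (2 * Λ)) • w)
  have h7 := sq_nonneg ‖ξ - (1 / (2 * Λ)) • w‖
  have h8 : ‖(1 / (2 * Λ)) • w‖ ^ 2 = (1 / (2 * Λ)) ^ 2 * ‖w‖ ^ 2 := by
    rw [norm_smul, mul_pow, Real.norm_of_nonneg (by positivity)]
  rw [map_add, inner_add_left, inner_add_right, inner_add_right, ← hw, map_smul] at h1
  rw [map_smul] at h3
  simp only [inner_smul_left, inner_smul_right, conj_trivial] at h1 h3 h5 h6
  rw [h4, ← hw, real_inner_self_eq_norm_sq] at h1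
  rw [h8] at h5 h6
  refine abs_le_of_sq_le_sq' ?_ (by positivity) |>.2
  have h9 : ‖w‖ ^ 2 / Λ ≤ Λ * (2 * ‖ξ‖ ^ 2 + 2 * ((1 / (2 * Λ)) ^ 2 * ‖w‖ ^ 2)) := by
    have h10 : ‖w‖ ^ 2 / Λ = 1 / (2 * Λ) * ‖w‖ ^ 2 + 1 / (2 * Λ) * ‖w‖ ^ 2 := by
      field_simp; norm_num
    calc ‖w‖ ^ 2 / Λ ≤ Λ * ‖ξ + (1 / (2 * Λ)) • w‖ ^ 2 := by linarith
      _ ≤ _ := by gcongr; linarith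
  rw [div_le_iff₀ hΛ] at h9
  field_simp at h9
  nlinarith

/-- The Hessian of a uniform solution is constant. -/
theorem exists_hess_eq (hn : 0 < n) (h : UniformSolution u g H l Λ) :
    ∃ A : (𝔼 n) →L[ℝ] 𝔼 n, ∀ x, H x = A := by
  have hM : ∀ e, ∃ M, IsLUB (range fun x => ⟪H x e, e⟫) M := fun e =>
    Real.exists_isLUB (range_nonempty _) ⟨Λ * ‖e‖ ^ 2, by rintro _ ⟨x, rfl⟩; exact h.hess_le x e⟩
  choose M hM using hM
  have hcomp : IsCompact (closure (range H)) := by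
    refine (Metric.isBounded_iff_subset_closedBall (0 : (𝔼 n) →L[ℝ] 𝔼 n)).2
      ⟨2 * Λ, ?_⟩ |>.isCompact_closure
    rintro _ ⟨x, rfl⟩
    exact mem_closedBall_zero_iff.2 (h.norm_hess_le x)
  have hcont : ∀ ξ η : 𝔼 n, Continuous fun T : (𝔼 n) →L[ℝ] 𝔼 n => ⟪T ξ, η⟫ := fun ξ η => by
    fun_prop
  obtain ⟨A, hA, hAM⟩ := hcomp.inter_iInter_nonempty
    (fun p : (𝔼 n) × ↥(Ioi (0 : ℝ)) => {T : (𝔼 n) →L[ℝ] 𝔼 n | M p.1 - p.2 ≤ ⟪T p.1, p.1⟫})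
    (fun p => isClosed_le continuous_const (hcont _ _)) (fun F => by
      obtain ⟨x, hx⟩ := h.exists_forall_le_inner_hess hn hM F
      exact ⟨H x, subset_closure (mem_range_self x), mem_iInter₂.2 hx⟩)
  have hle : ∀ x ξ, ⟪H x ξ, ξ⟫ ≤ ⟪A ξ, ξ⟫ := fun x ξ => by
    refine le_trans ((hM ξ).1 (mem_range_self x)) (le_of_forall_pos_sub_le fun δ hδ => ?_)
    exact mem_iInter.1 hAM (ξ, ⟨δ, hδ⟩)
  have hsymm : ∀ ξ η, ⟪A ξ, η⟫ = ⟪ξ, A η⟫ := fun ξ η => by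
    have hcl : IsClosed {T : (𝔼 n) →L[ℝ] 𝔼 n | ⟪T ξ, η⟫ = ⟪ξ, T η⟫} :=
      isClosed_eq (hcont ξ η) (by fun_prop)
    refine closure_minimal ?_ hcl hA
    rintro _ ⟨x, rfl⟩
    exact (h.isPositive x).inner_left_eq_inner_right ξ η
  have hdet : A.det = 1 := by
    refine closure_minimal ?_ (isClosed_eq (ContinuousLinearMap.continuous_det)
      continuous_const) hA
    rintro _ ⟨x, rfl⟩
    exact h.det_eq x
  have hApos : A.IsPositive := by
    refine (ContinuousLinearMap.isPositive_iff A).2 ⟨hsymm, fun ξ => ?_⟩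
    exact ((h.isPositive 0).inner_nonneg_left ξ).trans (hle 0 ξ)
  obtain ⟨b, hb⟩ := exists_isFrame hApos hdet
  refine ⟨A, fun x => ?_⟩
  have hdiff : (A - H x).IsPositive := by
    refine (ContinuousLinearMap.isPositive_iff _).2 ⟨fun ξ η => ?_, fun ξ => ?_⟩
    · have := (h.isPositive x).inner_left_eq_inner_right ξ η
      simp only [ContinuousLinearMap.coe_coe, sub_apply, inner_sub_left, inner_sub_right]
      rw [hsymm, this]
    · rw [sub_apply, inner_sub_left]
      exact sub_nonneg.2 (hle x ξ)
  have hsum := hb.le_sum (h.isPositive x) (h.det_eq x)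
  refine (sub_eq_zero.1 (hb.eq_zero _ hdiff ?_)).symm
  simp only [sub_apply, inner_sub_left, Finset.sum_sub_distrib, hb.sum_self]
  linarith

end UniformSolution

/-- Entire solutions are quadratic polynomials. -/
theorem Solution.exists_eq_quadratic {u : (𝔼 n) → ℝ} {g : (𝔼 n) → 𝔼 n}
    {H : (𝔼 n) → (𝔼 n) →L[ℝ] 𝔼 n} (hn : 0 < n) (h : Solution u g H) :
    ∃ A : (𝔼 n) →L[ℝ] 𝔼 n, ∀ x, u x = u 0 + ⟪g 0, x⟫ + ⟪A x, x⟫ / 2 := by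
  obtain ⟨l, Λ, hl, hΛ, hlow, hup⟩ := h.exists_hess_bounds hn
  obtain ⟨A, hA⟩ := UniformSolution.exists_hess_eq hn
    (⟨h, hl, hΛ, hlow, hup⟩ : UniformSolution u g H l Λ)
  refine ⟨A, fun x => ?_⟩
  obtain ⟨y, hy⟩ := h.exists_gap_eq 0 x
  rw [hA, gap, sub_zero] at hy
  linarith

theorem exists_hasHessian {f : (𝔼 n) → ℝ} (hf : ContDiff ℝ 2 f) :
    ∃ g H, HasHessian f g H ∧ ∀ x (i j : Fin n),
      H x (EuclideanSpace.single j 1) i =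
        iteratedFDeriv ℝ 2 f x ![EuclideanSpace.single j 1, EuclideanSpace.single i 1] := by
  have hf1 : ContDiff ℝ 1 (fderiv ℝ f) := hf.fderiv_right (by norm_num)
  have hd : ∀ x, HasFDerivAt (fderiv ℝ f) (fderiv ℝ (fderiv ℝ f) x) x := fun x =>
    (hf1.differentiable one_ne_zero x).hasFDerivAt
  have hc : Continuous (fderiv ℝ (fderiv ℝ f)) := hf1.continuous_fderiv one_ne_zero
  refine ⟨fun x => ∑ i, fderiv ℝ f x (EuclideanSpace.single i 1) • EuclideanSpace.single i 1,
    fun x => ∑ i, ((fderiv ℝ (fderiv ℝ f) x).flip (EuclideanSpace.single i 1)).smulRight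
      (EuclideanSpace.single i 1), ⟨fun x => ?_, fun x => ?_, ?_⟩, fun x i j => ?_⟩
  · refine (hf.differentiable two_ne_zero x).hasFDerivAt.congr_fderiv ?_
    ext v
    rw [innerSL_apply_apply, sum_inner]
    conv_lhs => rw [← (EuclideanSpace.basisFun (Fin n) ℝ).sum_repr v, map_sum]
    refine Finset.sum_congr rfl fun i _ => ?_
    simp [inner_smul_left, EuclideanSpace.inner_single_left, mul_comm]
  · refine HasFDerivAt.fun_sum fun i _ => ?_
    refine HasFDerivAt.smul_const ?_ _
    refine ((hd x).clm_apply (hasFDerivAt_const _ x)).congr_fderiv ?_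
    ext v; simp
  · refine continuous_finsetSum _ fun i _ => ?_
    exact ((ContinuousLinearMap.smulRightL ℝ (𝔼 n) (𝔼 n)).flip
      (EuclideanSpace.single i 1)).continuous.comp
        (((ContinuousLinearMap.flipₗᵢ ℝ (𝔼 n) (𝔼 n) ℝ).continuous.comp hc).clm_apply
          continuous_const)
  · rw [iteratedFDeriv_two_apply, sum_apply]
    simp [Pi.single_apply]

theorem det_eq_det_hessian {f : (𝔼 n) → ℝ} {T : (𝔼 n) →L[ℝ] 𝔼 n} {x : 𝔼 n}
    (h : ∀ i j : Fin n, T (EuclideanSpace.single j 1) i =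
        iteratedFDeriv ℝ 2 f x ![EuclideanSpace.single j 1, EuclideanSpace.single i 1]) :
    T.det = (Matrix.of fun i j : Fin n =>
      iteratedFDeriv ℝ 2 f x ![EuclideanSpace.single i 1, EuclideanSpace.single j 1]).det := by
  rw [ContinuousLinearMap.det, ← LinearMap.det_toMatrix (EuclideanSpace.basisFun (Fin n) ℝ).toBasis,
    ← Matrix.det_transpose]
  congr 1
  ext i j
  simp [LinearMap.toMatrix_apply, h]

theorem HasHessian.tangent_le {u : (𝔼 n) → ℝ} {g : (𝔼 n) → 𝔼 n} {H : (𝔼 n) → (𝔼 n) →L[ℝ] 𝔼 n}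
    (h : HasHessian u g H) (hu : ConvexOn ℝ univ u) (z x : 𝔼 n) : u z + ⟪g z, x - z⟫ ≤ u x := by
  have hφ : ConvexOn ℝ univ (u ∘ AffineMap.lineMap (k := ℝ) z x) := by
    simpa using hu.comp_affineMap (AffineMap.lineMap (k := ℝ) z x)
  have hder : HasDerivAt (u ∘ AffineMap.lineMap (k := ℝ) z x) ⟪g z, x - z⟫ (0 : ℝ) := by
    have := h.hasDerivAt_line z (x - z) 0
    simp only [zero_smul, add_zero] at this
    refine this.congr_of_eventuallyEq (Eventually.of_forall fun t => ?_)
    simp [AffineMap.lineMap_apply, add_comm]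
  have := hφ.le_slope_of_hasDerivAt (mem_univ _) (mem_univ _) zero_lt_one hder
  simp only [slope_def_field, Function.comp, AffineMap.lineMap_apply_zero,
    AffineMap.lineMap_apply_one, sub_zero, div_one] at this
  linarith

end MongeAmpere

/-- Jörgens–Calabi–Pogorelov theorem: a convex entire `C²` solution of the
Monge–Ampère equation `det Hess f = 1` on `ℝⁿ` is a quadratic polynomial
`f(x) = a + ⟨b, x⟩ + ⟨x, A x⟩`. -/
theorem stmt4 (n : ℕ) (hn : 0 < n)
    (f : EuclideanSpace ℝ (Fin n) → ℝ)
    (hf : ContDiff ℝ 2 f)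
    (hconv : ConvexOn ℝ Set.univ f)
    (heq : ∀ x, (hessian n f x).det = 1) :
    ∃ (c : ℝ) (b : EuclideanSpace ℝ (Fin n)) (A : Matrix (Fin n) (Fin n) ℝ),
      ∀ x, f x = c + ⟪b, x⟫ + ⟪x, (WithLp.equiv 2 (Fin n → ℝ)).symm (A.mulVec x)⟫ := by
  obtain ⟨g, H, hH, hcoord⟩ := MongeAmpere.exists_hasHessian hf
  have hsol : MongeAmpere.Solution f g H :=
    { toHasHessian := hH
      tangent_le := hH.tangent_le hconv
      det_eq := fun x => (MongeAmpere.det_eq_det_hessian (hcoord x)).trans (heq x) }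
  obtain ⟨A, hA⟩ := hsol.exists_eq_quadratic hn
  refine ⟨f 0, g 0, (1 / 2 : ℝ) • Matrix.toEuclideanCLM (𝕜 := ℝ).symm A, fun x => ?_⟩
  have hAx : (WithLp.equiv 2 (Fin n → ℝ)).symm
      (((1 / 2 : ℝ) • Matrix.toEuclideanCLM (𝕜 := ℝ).symm A).mulVec x) = (1 / 2 : ℝ) • A x := by
    have h1 := Matrix.toEuclideanCLM_toLp (𝕜 := ℝ) (Matrix.toEuclideanCLM (𝕜 := ℝ).symm A) x
    rw [StarAlgEquiv.apply_symm_apply] at h1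
    rw [Matrix.smul_mulVec]
    exact congrArg ((1 / 2 : ℝ) • ·) h1.symm
  rw [hAx, inner_smul_right, real_inner_comm (A x) x, hA x]
  ring
end

section
/- Let f : ℝⁿ → ℝ be a convex C² function with lim sup_{‖x‖→∞} |f(x)|/‖x‖² = 0. Then for every ε > 0 there exists a point x₀ ∈ ℝⁿ such that Hess f(x₀) ≤ ε·I, i.e. the matrix ε·I − Hess f(x₀) is positive semidefinite. -/
open scoped RealInnerProductSpace

theorem IsLocalMin.deriv_deriv_nonneg {h : ℝ → ℝ} {a : ℝ} (hmin : IsLocalMin h a)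
    (hc : ContinuousAt h a) : 0 ≤ deriv (deriv h) a := by
  by_contra! hneg
  have hmax := isLocalMax_of_deriv_deriv_neg hneg hmin.deriv_eq_zero hc
  have hconst : h =ᶠ[nhds a] fun _ => h a := by
    filter_upwards [hmin, hmax] with t h₁ h₂
    exact le_antisymm h₂ h₁
  have hzero : deriv (deriv h) a = 0 := by
    rw [hconst.deriv.deriv_eq]
    simp
  exact hneg.ne hzero

theorem fderiv_fderiv_le_of_forall_quadratic_sub_le {E : Type*} [NormedAddCommGroup E]
    [InnerProductSpace ℝ E] {f : E → ℝ} (hf : ContDiff ℝ 2 f) {ε : ℝ} {x₀ : E}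
    (hmin : ∀ y, ε / 2 * ‖x₀‖ ^ 2 - f x₀ ≤ ε / 2 * ‖y‖ ^ 2 - f y) (v : E) :
    fderiv ℝ (fderiv ℝ f) x₀ v v ≤ ε * ‖v‖ ^ 2 := by
  have hline (t : ℝ) : HasDerivAt (fun t : ℝ => x₀ + t • v) v t := by
    simpa using ((hasDerivAt_id t).smul_const v).const_add x₀
  have hderiv (t : ℝ) :
      HasDerivAt (fun t : ℝ => ε / 2 * ‖x₀ + t • v‖ ^ 2 - f (x₀ + t • v))
        (ε * ⟪x₀ + t • v, v⟫ - fderiv ℝ f (x₀ + t • v) v) t := by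
    have hfx := (hf.differentiable (by norm_num) (x₀ + t • v)).hasFDerivAt
    convert! ((hline t).norm_sq.const_mul (ε / 2)).sub (hfx.comp_hasDerivAt t (hline t)) using 1
    ring
  have hderiv₂ :
      HasDerivAt (fun t : ℝ => ε * ⟪x₀ + t • v, v⟫ - fderiv ℝ f (x₀ + t • v) v)
        (ε * ‖v‖ ^ 2 - fderiv ℝ (fderiv ℝ f) x₀ v v) 0 := by
    have hf' : HasFDerivAt (fderiv ℝ f) (fderiv ℝ (fderiv ℝ f) x₀) (x₀ + (0 : ℝ) • v) := by
      simpa using ((hf.fderiv_right (m := 1) (by norm_num)).differentiable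
        (by norm_num) x₀).hasFDerivAt
    have h₁ := ((hline 0).inner ℝ (hasDerivAt_const (0 : ℝ) v)).const_mul ε
    have happly : HasFDerivAt (fun y => fderiv ℝ f y v)
        ((ContinuousLinearMap.apply ℝ ℝ v).comp (fderiv ℝ (fderiv ℝ f) x₀)) (x₀ + (0 : ℝ) • v) :=
      (ContinuousLinearMap.apply ℝ ℝ v).hasFDerivAt.comp (x₀ + (0 : ℝ) • v) hf'
    have h₂ := happly.comp_hasDerivAt (0 : ℝ) (hline 0)
    convert! h₁.sub h₂ using 1
    simp
  have hlocal :
      IsLocalMin (fun t : ℝ => ε / 2 * ‖x₀ + t • v‖ ^ 2 - f (x₀ + t • v)) 0 :=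
    Filter.Eventually.of_forall fun t => by simpa using hmin (x₀ + t • v)
  have hnonneg := hlocal.deriv_deriv_nonneg (hderiv 0).continuousAt
  rw [funext fun t => (hderiv t).deriv, hderiv₂.deriv] at hnonneg
  linarith

theorem QuadDecay.tendsto_quadratic_sub {n : ℕ} {f : EuclideanSpace ℝ (Fin n) → ℝ}
    (hgrowth : QuadDecay n f) {ε : ℝ} (hε : 0 < ε) :
    Filter.Tendsto (fun x => ε / 2 * ‖x‖ ^ 2 - f x)
      (Filter.cocompact (EuclideanSpace ℝ (Fin n))) Filter.atTop := by
  have hlim := hgrowth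
  rw [QuadDecay, comap_norm_atTop, Metric.cobounded_eq_cocompact] at hlim
  have hnorm := tendsto_norm_cocompact_atTop (E := EuclideanSpace ℝ (Fin n))
  refine Filter.tendsto_atTop_mono' _ ?_ (hnorm.const_mul_atTop (show 0 < ε / 4 by positivity))
  filter_upwards [hlim.eventually_lt_const (show 0 < ε / 4 by positivity),
    hnorm.eventually_ge_atTop 1] with x hx h₁
  rw [div_lt_iff₀ (by positivity)] at hx
  have hfx := le_abs_self (f x)
  have hsq : ε / 4 * ‖x‖ ≤ ε / 4 * ‖x‖ ^ 2 := by
    gcongr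
    exact le_self_pow₀ h₁ two_ne_zero
  linarith

theorem hessian_isHermitian {n : ℕ} {f : EuclideanSpace ℝ (Fin n) → ℝ} (hf : ContDiff ℝ 2 f)
    (x : EuclideanSpace ℝ (Fin n)) : (hessian n f x).IsHermitian := by
  ext i j
  simpa [hessian, iteratedFDeriv_two_apply] using
    hf.contDiffAt.isSymmSndFDerivAt (by simp) _ _

theorem dotProduct_hessian_mulVec {n : ℕ} (f : EuclideanSpace ℝ (Fin n) → ℝ)
    (x v : EuclideanSpace ℝ (Fin n)) :
    v.ofLp ⬝ᵥ (hessian n f x).mulVec v.ofLp = fderiv ℝ (fderiv ℝ f) x v v := by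
  have hv : v = ∑ i, v i • EuclideanSpace.single i (1 : ℝ) := by
    simpa using ((EuclideanSpace.basisFun (Fin n) ℝ).sum_repr v).symm
  conv_rhs => rw [hv]
  simp only [map_sum, map_smul, FunLike.coe_sum, Finset.sum_apply, FunLike.coe_smul, Pi.smul_apply,
    smul_eq_mul, dotProduct, Matrix.mulVec, hessian, iteratedFDeriv_two_apply, Matrix.of_apply,
    Matrix.cons_val_zero, Matrix.cons_val_one, Finset.mul_sum]
  rw [Finset.sum_comm]
  refine Finset.sum_congr rfl fun i _ => Finset.sum_congr rfl fun j _ => ?_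
  ring

/-- Key step of the proof: if `f : ℝⁿ → ℝ` is convex, `C²` and
`lim sup_{‖x‖→∞} |f(x)|/‖x‖² = 0`, then for every `ε > 0` there is a point `x₀` with
`Hess f(x₀) ≤ ε I`, i.e. `ε I − Hess f(x₀)` is positive semidefinite. -/
theorem stmt8 (n : ℕ) (hn : 0 < n)
    (f : EuclideanSpace ℝ (Fin n) → ℝ)
    (hf : ContDiff ℝ 2 f)
    (hconv : ConvexOn ℝ Set.univ f)
    (hgrowth : QuadDecay n f) :
    ∀ ε : ℝ, 0 < ε → ∃ x₀ : EuclideanSpace ℝ (Fin n),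
      (ε • (1 : Matrix (Fin n) (Fin n) ℝ) - hessian n f x₀).PosSemidef := by
  intro ε hε
  have hcont : Continuous fun x : EuclideanSpace ℝ (Fin n) => ε / 2 * ‖x‖ ^ 2 - f x :=
    (continuous_const.mul (continuous_norm.pow 2)).sub hf.continuous
  obtain ⟨x₀, hx₀⟩ := hcont.exists_forall_le (hgrowth.tendsto_quadratic_sub hε)
  refine ⟨x₀, .of_dotProduct_mulVec_nonneg ?_ fun w => ?_⟩
  · exact (Matrix.isHermitian_one.smul (IsSelfAdjoint.all ε)).sub (hessian_isHermitian hf x₀)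
  · have hle := fderiv_fderiv_le_of_forall_quadratic_sub_le hf hx₀ (WithLp.toLp 2 w)
    rw [← dotProduct_hessian_mulVec, EuclideanSpace.real_norm_sq_eq] at hle
    have hw : w ⬝ᵥ w = ∑ i, w i ^ 2 := by simp [dotProduct, sq]
    simpa [Matrix.sub_mulVec, Matrix.smul_mulVec, dotProduct_sub, hw] using hle
end
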